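/- arXiv:math/0604415 — 10 statements merged into one kernel-verified Lean document; each statement's English description precedes it below -/
import Mathlib

section
/- Let ψ be a C² function on an open interval I ⊆ (0,∞) satisfying the ODE ψ''(y) = y ψ'(y)³ on I, and suppose ψ' never vanishes on I. Then there exist constants a ≠ 0 and b ∈ ℝ such that |a y| < 1 for all y ∈ I and ψ(y) = arcsin(a y) + b for all y ∈ I. -/
open Real MeasureTheory

/-- Partial derivative in the first variable. -/
noncomputable def px (f : ℝ → ℝ → ℝ) (x y : ℝ) : ℝ := deriv (fun t => f t y) x

/-- Partial derivative in the second variable. -/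
noncomputable def py (f : ℝ → ℝ → ℝ) (x y : ℝ) : ℝ := deriv (fun t => f x t) y

/-- Left-hand side of the minimal surface equation in `ℍ² × ℝ` (upper half-plane model):
`(1 + y² f_y²) f_xx − y (f_x² + f_y²) f_y − 2 y² f_x f_y f_xy + (1 + y² f_x²) f_yy`. -/
noncomputable def minExpr (f : ℝ → ℝ → ℝ) (x y : ℝ) : ℝ :=
  (1 + y ^ 2 * (py f x y) ^ 2) * px (px f) x y
    - y * ((px f x y) ^ 2 + (py f x y) ^ 2) * py f x y
    - 2 * y ^ 2 * px f x y * py f x y * py (px f) x y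
    + (1 + y ^ 2 * (px f x y) ^ 2) * py (py f) x y

/-- The minimal surface equation in `ℍ² × ℝ`. -/
def MinimalEq (f : ℝ → ℝ → ℝ) (x y : ℝ) : Prop := minExpr f x y = 0

/-- If `u' = y u³`, then `u / √(1 + y² u²)` has zero derivative. -/
lemma hasDerivAt_div_sqrt_one_add_sq {u : ℝ → ℝ} {y : ℝ}
    (hu : HasDerivAt u (y * u y ^ 3) y) :
    HasDerivAt (fun t => u t / √(1 + (t * u t) ^ 2)) 0 y := by
  have hpos : 0 < 1 + (y * u y) ^ 2 := by positivity
  have hs : √(1 + (y * u y) ^ 2) ≠ 0 := (Real.sqrt_pos.2 hpos).ne'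
  have hsq : √(1 + (y * u y) ^ 2) ^ 2 = 1 + (y * u y) ^ 2 := Real.sq_sqrt hpos.le
  have h := hu.div (((((hasDerivAt_id' y).mul hu).pow 2).const_add 1).sqrt hpos.ne') hs
  refine h.congr_deriv ?_
  simp only [Pi.mul_apply, Pi.pow_apply]
  generalize √(1 + (y * u y) ^ 2) = s at hs hsq ⊢
  field_simp
  rw [hsq]
  push_cast
  ring

/-- If `ψ' = u` and `u' = y u³`, then `ψ - arctan (y u)` has zero derivative. -/
lemma hasDerivAt_sub_arctan_mul {ψ u : ℝ → ℝ} {y : ℝ} (hψ : HasDerivAt ψ (u y) y)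
    (hu : HasDerivAt u (y * u y ^ 3) y) :
    HasDerivAt (fun t => ψ t - Real.arctan (t * u t)) 0 y := by
  have hpos : 0 < 1 + (y * u y) ^ 2 := by positivity
  refine (hψ.sub ((hasDerivAt_id' y).mul hu).arctan).congr_deriv ?_
  simp only [Pi.mul_apply]
  field_simp
  ring

/-- A function with zero derivative on an open interval is constant there. -/
lemma exists_eq_of_hasDerivAt_zero {I : Set ℝ} (hIo : IsOpen I) (hIc : I.OrdConnected)
    {f : ℝ → ℝ} (hf : ∀ y ∈ I, HasDerivAt f 0 y) : ∃ c, ∀ y ∈ I, f y = c :=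
  hIo.exists_is_const_of_deriv_eq_zero hIc.isPreconnected
    (fun y hy => (hf y hy).differentiableAt.differentiableWithinAt) (fun y hy => (hf y hy).deriv)

/-- Solutions of `ψ'' = y (ψ')³` with nonvanishing `ψ'` on an open interval `I ⊆ (0,∞)`
are of the form `ψ(y) = arcsin(a y) + b`, `a ≠ 0`, with `|a y| < 1` on `I`. -/
theorem ode_solutions_arcsin
    (I : Set ℝ) (hIo : IsOpen I) (hIc : I.OrdConnected) (hIsub : I ⊆ Set.Ioi (0 : ℝ))
    (ψ : ℝ → ℝ) (hψ : ContDiffOn ℝ 2 ψ I)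
    (hode : ∀ y ∈ I, deriv (deriv ψ) y = y * (deriv ψ y) ^ 3)
    (hψ' : ∀ y ∈ I, deriv ψ y ≠ 0) :
    ∃ a b : ℝ, a ≠ 0 ∧ ∀ y ∈ I, |a * y| < 1 ∧ ψ y = Real.arcsin (a * y) + b := by
  have hd1 (y) (hy : y ∈ I) : HasDerivAt ψ (deriv ψ y) y :=
    ((hψ.contDiffAt (hIo.mem_nhds hy)).differentiableAt (by norm_num)).hasDerivAt
  have hd2 (y) (hy : y ∈ I) : HasDerivAt (deriv ψ) (y * deriv ψ y ^ 3) y := by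
    rw [← hode y hy]
    exact ((((contDiffOn_succ_iff_deriv_of_isOpen (n := 1) hIo).1 hψ).2.2.contDiffAt
      (hIo.mem_nhds hy)).differentiableAt (by norm_num)).hasDerivAt
  rcases I.eq_empty_or_nonempty with rfl | ⟨y₀, hy₀⟩
  · exact ⟨1, 0, one_ne_zero, by simp⟩
  obtain ⟨a, ha⟩ := exists_eq_of_hasDerivAt_zero hIo hIc
    fun y hy => hasDerivAt_div_sqrt_one_add_sq (hd2 y hy)
  obtain ⟨b, hb⟩ := exists_eq_of_hasDerivAt_zero hIo hIc
    fun y hy => hasDerivAt_sub_arctan_mul (hd1 y hy) (hd2 y hy)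
  refine ⟨a, b, ?_, fun y hy => ?_⟩
  · rw [← ha y₀ hy₀]
    exact div_ne_zero (hψ' y₀ hy₀) (Real.sqrt_pos.2 (by positivity)).ne'
  have hay : a * y = y * deriv ψ y / √(1 + (y * deriv ψ y) ^ 2) := by
    rw [← ha y hy]
    ring
  have hs : 0 < √(1 + (y * deriv ψ y) ^ 2) := Real.sqrt_pos.2 (by positivity)
  constructor
  · rw [hay, abs_div, abs_of_pos hs, div_lt_one hs]
    exact Real.lt_sqrt_of_sq_lt (by rw [sq_abs]; linarith)
  · rw [hay, ← Real.arctan_eq_arcsin, ← hb y hy]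
    ring
end

section
/- For any constants a, b ∈ ℝ, the function f(x,y) = a·ln(x² + y²) + b (the funnel surface) satisfies the minimal surface equation in H²×ℝ at every point of the upper half-plane {(x,y) ∈ ℝ² : y > 0}. -/
open Real MeasureTheory

theorem hasDerivAt_sq_add_const (x c : ℝ) :
    HasDerivAt (fun t : ℝ => t ^ 2 + c) (2 * x) x := by
  simpa using (hasDerivAt_pow 2 x).add_const c

theorem hasDerivAt_const_add_sq (c y : ℝ) :
    HasDerivAt (fun t : ℝ => c + t ^ 2) (2 * y) y := by
  simpa using (hasDerivAt_pow 2 y).const_add c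

theorem px_funnel (a b x : ℝ) {y : ℝ} (hy : 0 < y) :
    px (fun x y => a * Real.log (x ^ 2 + y ^ 2) + b) x y = 2 * a * x / (x ^ 2 + y ^ 2) := by
  have hr : x ^ 2 + y ^ 2 ≠ 0 := by positivity
  refine ((((hasDerivAt_sq_add_const x (y ^ 2)).log hr).const_mul a).add_const b).deriv.trans ?_
  ring

theorem py_funnel (a b x : ℝ) {y : ℝ} (hy : 0 < y) :
    py (fun x y => a * Real.log (x ^ 2 + y ^ 2) + b) x y = 2 * a * y / (x ^ 2 + y ^ 2) := by
  have hr : x ^ 2 + y ^ 2 ≠ 0 := by positivity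
  refine ((((hasDerivAt_const_add_sq (x ^ 2) y).log hr).const_mul a).add_const b).deriv.trans ?_
  ring

theorem px_px_funnel (a b x : ℝ) {y : ℝ} (hy : 0 < y) :
    px (px (fun x y => a * Real.log (x ^ 2 + y ^ 2) + b)) x y =
      2 * a * (y ^ 2 - x ^ 2) / (x ^ 2 + y ^ 2) ^ 2 := by
  have hr : x ^ 2 + y ^ 2 ≠ 0 := by positivity
  have h : (fun t => px (fun x y => a * Real.log (x ^ 2 + y ^ 2) + b) t y) =
      fun t => 2 * a * t / (t ^ 2 + y ^ 2) := funext fun t => px_funnel a b t hy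
  rw [px, h]
  refine (((hasDerivAt_id' x).const_mul (2 * a)).fun_div
    (hasDerivAt_sq_add_const x (y ^ 2)) hr).deriv.trans ?_
  ring

theorem py_px_funnel (a b x : ℝ) {y : ℝ} (hy : 0 < y) :
    py (px (fun x y => a * Real.log (x ^ 2 + y ^ 2) + b)) x y =
      -(4 * a * x * y) / (x ^ 2 + y ^ 2) ^ 2 := by
  have hr : x ^ 2 + y ^ 2 ≠ 0 := by positivity
  have h : (fun t => px (fun x y => a * Real.log (x ^ 2 + y ^ 2) + b) x t) =ᶠ[nhds y]
      fun t => 2 * a * x / (x ^ 2 + t ^ 2) := by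
    filter_upwards [lt_mem_nhds hy] with t ht using px_funnel a b x ht
  rw [py, h.deriv_eq]
  refine ((hasDerivAt_const y (2 * a * x)).fun_div
    (hasDerivAt_const_add_sq (x ^ 2) y) hr).deriv.trans ?_
  ring

theorem py_py_funnel (a b x : ℝ) {y : ℝ} (hy : 0 < y) :
    py (py (fun x y => a * Real.log (x ^ 2 + y ^ 2) + b)) x y =
      2 * a * (x ^ 2 - y ^ 2) / (x ^ 2 + y ^ 2) ^ 2 := by
  have hr : x ^ 2 + y ^ 2 ≠ 0 := by positivity
  have h : (fun t => py (fun x y => a * Real.log (x ^ 2 + y ^ 2) + b) x t) =ᶠ[nhds y]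
      fun t => 2 * a * t / (x ^ 2 + t ^ 2) := by
    filter_upwards [lt_mem_nhds hy] with t ht using py_funnel a b x ht
  rw [py, h.deriv_eq]
  refine (((hasDerivAt_id' y).const_mul (2 * a)).fun_div
    (hasDerivAt_const_add_sq (x ^ 2) y) hr).deriv.trans ?_
  ring

/-- The funnel surface `f(x,y) = a ln(x² + y²) + b` is a minimal graph in `ℍ² × ℝ`. -/
theorem funnel_surface_is_minimal (a b : ℝ) :
    ∀ x y : ℝ, 0 < y →
      MinimalEq (fun x y => a * Real.log (x ^ 2 + y ^ 2) + b) x y := by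
  intro x y hy
  have hr : x ^ 2 + y ^ 2 ≠ 0 := by positivity
  rw [MinimalEq, minExpr, px_funnel a b x hy, py_funnel a b x hy, px_px_funnel a b x hy,
    py_px_funnel a b x hy, py_py_funnel a b x hy]
  field_simp
  ring
end

section
/- Let h be a C² function on (0,∞) and define f(x,y) = h(x² + y²) on the upper half-plane {(x,y) ∈ ℝ² : y > 0}. Then f satisfies the minimal surface equation in H²×ℝ at every point of the upper half-plane if and only if z·h''(z) + h'(z) = 0 for all z ∈ (0,∞). -/
open Real MeasureTheory

theorem HasDerivAt.comp_sq_add_left {g : ℝ → ℝ} {g' x y : ℝ}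
    (hg : HasDerivAt g g' (x ^ 2 + y ^ 2)) :
    HasDerivAt (fun t => g (t ^ 2 + y ^ 2)) (2 * x * g') x := by
  have h₁ : HasDerivAt (fun t : ℝ => t ^ 2 + y ^ 2) (2 * x) x := by
    simpa using (hasDerivAt_pow 2 x).add_const (y ^ 2)
  have h₂ := HasDerivAt.comp x (h := fun t : ℝ => t ^ 2 + y ^ 2) hg h₁
  rw [mul_comm]
  exact h₂

theorem HasDerivAt.comp_sq_add_right {g : ℝ → ℝ} {g' x y : ℝ}
    (hg : HasDerivAt g g' (x ^ 2 + y ^ 2)) :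
    HasDerivAt (fun t => g (x ^ 2 + t ^ 2)) (2 * y * g') y := by
  rw [add_comm] at hg
  simpa only [add_comm] using hg.comp_sq_add_left

/-- On a radial graph the cubic terms of the minimal surface equation cancel. -/
theorem minExpr_radial {h : ℝ → ℝ} (hd : ∀ z, 0 < z → DifferentiableAt ℝ h z)
    (hdd : ∀ z, 0 < z → DifferentiableAt ℝ (deriv h) z) {x y : ℝ} (hy : 0 < y) :
    minExpr (fun x y => h (x ^ 2 + y ^ 2)) x y =
      4 * ((x ^ 2 + y ^ 2) * deriv (deriv h) (x ^ 2 + y ^ 2) + deriv h (x ^ 2 + y ^ 2)) := by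
  have pos : ∀ s t : ℝ, 0 < t → 0 < s ^ 2 + t ^ 2 := fun s t ht => by positivity
  have hpx : ∀ s t : ℝ, 0 < t →
      px (fun x y => h (x ^ 2 + y ^ 2)) s t = 2 * s * deriv h (s ^ 2 + t ^ 2) :=
    fun s t ht => (hd _ (pos s t ht)).hasDerivAt.comp_sq_add_left.deriv
  have hpy : ∀ s t : ℝ, 0 < t →
      py (fun x y => h (x ^ 2 + y ^ 2)) s t = 2 * t * deriv h (s ^ 2 + t ^ 2) :=
    fun s t ht => (hd _ (pos s t ht)).hasDerivAt.comp_sq_add_right.deriv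
  have hh' := (hdd _ (pos x y hy)).hasDerivAt
  have near : ∀ᶠ t in nhds y, 0 < t := lt_mem_nhds hy
  have hxx : px (px (fun x y => h (x ^ 2 + y ^ 2))) x y =
      2 * deriv h (x ^ 2 + y ^ 2) + 2 * x * (2 * x * deriv (deriv h) (x ^ 2 + y ^ 2)) := by
    rw [px, funext fun s => hpx s y hy]
    simpa [Pi.mul_def] using (((hasDerivAt_id x).const_mul 2).mul hh'.comp_sq_add_left).deriv
  have hxy : py (px (fun x y => h (x ^ 2 + y ^ 2))) x y =
      2 * x * (2 * y * deriv (deriv h) (x ^ 2 + y ^ 2)) := by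
    rw [py, Filter.EventuallyEq.deriv_eq (near.mono fun t ht => hpx x t ht)]
    exact (hh'.comp_sq_add_right.const_mul (2 * x)).deriv
  have hyy : py (py (fun x y => h (x ^ 2 + y ^ 2))) x y =
      2 * deriv h (x ^ 2 + y ^ 2) + 2 * y * (2 * y * deriv (deriv h) (x ^ 2 + y ^ 2)) := by
    rw [py, Filter.EventuallyEq.deriv_eq (near.mono fun t ht => hpy x t ht)]
    simpa [Pi.mul_def] using (((hasDerivAt_id y).const_mul 2).mul hh'.comp_sq_add_right).deriv
  rw [minExpr, hxx, hxy, hyy, hpx x y hy, hpy x y hy]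
  ring

/-- The radial graph `f(x,y) = h(x² + y²)` solves the minimal surface equation in `ℍ² × ℝ`
on the whole upper half-plane iff `z h''(z) + h'(z) = 0` on `(0,∞)`. -/
theorem radial_minimal_graph
    (h : ℝ → ℝ) (hh : ContDiffOn ℝ 2 h (Set.Ioi (0 : ℝ))) :
    (∀ x y : ℝ, 0 < y → MinimalEq (fun x y => h (x ^ 2 + y ^ 2)) x y) ↔
      ∀ z ∈ Set.Ioi (0 : ℝ), z * deriv (deriv h) z + deriv h z = 0 := by
  have hd : ∀ z, 0 < z → DifferentiableAt ℝ h z := fun z hz =>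
    (hh.contDiffAt (Ioi_mem_nhds hz)).differentiableAt (by norm_num)
  have hdd : ∀ z, 0 < z → DifferentiableAt ℝ (deriv h) z := fun z hz =>
    (((contDiffOn_succ_iff_deriv_of_isOpen (n := 1) isOpen_Ioi).1
      (by simpa [one_add_one_eq_two] using hh)).2.2.contDiffAt
      (Ioi_mem_nhds hz)).differentiableAt (by norm_num)
  constructor
  · intro H z hz
    have hz' : 0 < z := hz
    have key := H 0 (√z) (Real.sqrt_pos.2 hz')
    rw [MinimalEq, minExpr_radial hd hdd (Real.sqrt_pos.2 hz'), Real.sq_sqrt hz'.le] at key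
    simpa using key
  · intro H x y hy
    rw [MinimalEq, minExpr_radial hd hdd hy,
      H _ (show 0 < x ^ 2 + y ^ 2 by positivity), mul_zero]
end

section
/- For any constant c ∈ ℝ, the function f(x,y) = c·x/(x² + y²) satisfies the minimal surface equation in H²×ℝ at every point of the upper half-plane {(x,y) ∈ ℝ² : y > 0}. -/
open Real MeasureTheory

/-- First partial derivative in `x` of `c x / (x² + y²)`. -/
lemma px_mul_div_sq_add_sq (c x : ℝ) {y : ℝ} (hy : 0 < y) :
    px (fun x y => c * x / (x ^ 2 + y ^ 2)) x y = c * (y ^ 2 - x ^ 2) / (x ^ 2 + y ^ 2) ^ 2 := by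
  have h : x ^ 2 + y ^ 2 ≠ 0 := by positivity
  refine HasDerivAt.deriv (f := fun t => c * t / (t ^ 2 + y ^ 2)) ?_
  refine (((hasDerivAt_id' x).const_mul c).fun_div
    ((hasDerivAt_pow 2 x).add_const (y ^ 2)) h).congr_deriv ?_
  field_simp
  push_cast
  ring

/-- First partial derivative in `y` of `c x / (x² + y²)`. -/
lemma py_mul_div_sq_add_sq (c x : ℝ) {y : ℝ} (hy : 0 < y) :
    py (fun x y => c * x / (x ^ 2 + y ^ 2)) x y = -(2 * c * x * y) / (x ^ 2 + y ^ 2) ^ 2 := by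
  have h : x ^ 2 + y ^ 2 ≠ 0 := by positivity
  refine HasDerivAt.deriv (f := fun t => c * x / (x ^ 2 + t ^ 2)) ?_
  refine ((hasDerivAt_const y (c * x)).fun_div
    ((hasDerivAt_pow 2 y).const_add (x ^ 2)) h).congr_deriv ?_
  field_simp
  push_cast
  ring

lemma px_px_mul_div_sq_add_sq (c x : ℝ) {y : ℝ} (hy : 0 < y) :
    px (px (fun x y => c * x / (x ^ 2 + y ^ 2))) x y =
      2 * c * x * (x ^ 2 - 3 * y ^ 2) / (x ^ 2 + y ^ 2) ^ 3 := by
  have h : x ^ 2 + y ^ 2 ≠ 0 := by positivity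
  have e : (fun t => px (fun x y => c * x / (x ^ 2 + y ^ 2)) t y) =
      fun t => c * (y ^ 2 - t ^ 2) / (t ^ 2 + y ^ 2) ^ 2 :=
    funext fun t => px_mul_div_sq_add_sq c t hy
  rw [px, e]
  refine HasDerivAt.deriv ?_
  refine ((((hasDerivAt_pow 2 x).const_sub (y ^ 2)).const_mul c).fun_div
    (((hasDerivAt_pow 2 x).add_const (y ^ 2)).fun_pow 2) (pow_ne_zero 2 h)).congr_deriv ?_
  field_simp
  push_cast
  ring

lemma py_px_mul_div_sq_add_sq (c x : ℝ) {y : ℝ} (hy : 0 < y) :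
    py (px (fun x y => c * x / (x ^ 2 + y ^ 2))) x y =
      2 * c * y * (3 * x ^ 2 - y ^ 2) / (x ^ 2 + y ^ 2) ^ 3 := by
  have h : x ^ 2 + y ^ 2 ≠ 0 := by positivity
  have e : (fun t => px (fun x y => c * x / (x ^ 2 + y ^ 2)) x t) =ᶠ[nhds y]
      fun t => c * (t ^ 2 - x ^ 2) / (x ^ 2 + t ^ 2) ^ 2 := by
    filter_upwards [lt_mem_nhds hy] with t ht using px_mul_div_sq_add_sq c x ht
  rw [py, e.deriv_eq]
  refine HasDerivAt.deriv ?_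
  refine ((((hasDerivAt_pow 2 y).sub_const (x ^ 2)).const_mul c).fun_div
    (((hasDerivAt_pow 2 y).const_add (x ^ 2)).fun_pow 2) (pow_ne_zero 2 h)).congr_deriv ?_
  field_simp
  push_cast
  ring

lemma py_py_mul_div_sq_add_sq (c x : ℝ) {y : ℝ} (hy : 0 < y) :
    py (py (fun x y => c * x / (x ^ 2 + y ^ 2))) x y =
      2 * c * x * (3 * y ^ 2 - x ^ 2) / (x ^ 2 + y ^ 2) ^ 3 := by
  have h : x ^ 2 + y ^ 2 ≠ 0 := by positivity
  have e : (fun t => py (fun x y => c * x / (x ^ 2 + y ^ 2)) x t) =ᶠ[nhds y]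
      fun t => -(2 * c * x * t) / (x ^ 2 + t ^ 2) ^ 2 := by
    filter_upwards [lt_mem_nhds hy] with t ht using py_mul_div_sq_add_sq c x ht
  rw [py, e.deriv_eq]
  refine HasDerivAt.deriv ?_
  refine (((hasDerivAt_id' y).const_mul (2 * c * x)).fun_neg.fun_div
    (((hasDerivAt_pow 2 y).const_add (x ^ 2)).fun_pow 2) (pow_ne_zero 2 h)).congr_deriv ?_
  field_simp
  push_cast
  ring

/-- The graph of `f(x,y) = c x/(x² + y²)` is minimal in `ℍ² × ℝ`. -/
theorem cx_over_r2_is_minimal (c : ℝ) :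
    ∀ x y : ℝ, 0 < y →
      MinimalEq (fun x y => c * x / (x ^ 2 + y ^ 2)) x y := by
  intro x y hy
  have h : x ^ 2 + y ^ 2 ≠ 0 := by positivity
  rw [MinimalEq, minExpr, px_mul_div_sq_add_sq c x hy, py_mul_div_sq_add_sq c x hy,
    px_px_mul_div_sq_add_sq c x hy, py_px_mul_div_sq_add_sq c x hy,
    py_py_mul_div_sq_add_sq c x hy]
  field_simp
  ring
end

section
/- For any constants a, b ∈ ℝ, the function f(x,y) = arcsin(a·y/(x² + y²)) + b satisfies the minimal surface equation in H²×ℝ at every point (x,y) of the upper half-plane {(x,y) ∈ ℝ² : y > 0} at which |a·y/(x² + y²)| < 1. -/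
open Real MeasureTheory

/-- Chain rule for `arcsin ∘ u + b`. -/
theorem hasDerivAt_arcsin_comp_add_const {u : ℝ → ℝ} {u' t : ℝ} (b : ℝ) (hu : HasDerivAt u u' t)
    (h : |u t| < 1) :
    HasDerivAt (fun s => Real.arcsin (u s) + b) (u' / √(1 - u t ^ 2)) t := by
  obtain ⟨h₁, h₂⟩ := abs_lt.1 h
  have := ((Real.hasDerivAt_arcsin h₁.ne' h₂.ne).comp t hu).add_const b
  refine this.congr_deriv ?_
  ring

/-- Quotient rule for `p / √(1 - u ^ 2)`. -/
theorem hasDerivAt_div_sqrt_one_sub_sq {u p : ℝ → ℝ} {u' p' t : ℝ} (hu : HasDerivAt u u' t)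
    (hp : HasDerivAt p p' t) (h : |u t| < 1) :
    HasDerivAt (fun s => p s / √(1 - u s ^ 2))
      (p' / √(1 - u t ^ 2) + p t * u t * u' / √(1 - u t ^ 2) ^ 3) t := by
  have hpos : 0 < 1 - u t ^ 2 := sub_pos.2 ((sq_lt_one_iff_abs_lt_one _).2 h)
  have hs : √(1 - u t ^ 2) ≠ 0 := (Real.sqrt_pos.2 hpos).ne'
  have := hp.div (((hu.pow 2).const_sub 1).sqrt hpos.ne') hs
  refine this.congr_deriv ?_
  simp only [Pi.pow_apply]
  field_simp
  ring

/-- The expression of `minExpr` for `arcsin ∘ u`, in terms of the partial derivatives of `u`. -/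
theorem minExpr_arcsin_comp_algebra {y u s p q pp pq qq : ℝ} (hs : s ≠ 0) (hsu : s ^ 2 = 1 - u ^ 2)
    (h : (1 - u ^ 2) * (pp + qq) + u * (p ^ 2 + q ^ 2)
      + y ^ 2 * (q ^ 2 * pp - 2 * p * q * pq + p ^ 2 * qq) - y * (p ^ 2 + q ^ 2) * q = 0) :
    (1 + y ^ 2 * (q / s) ^ 2) * (pp / s + p * u * p / s ^ 3)
      - y * ((p / s) ^ 2 + (q / s) ^ 2) * (q / s)
      - 2 * y ^ 2 * (p / s) * (q / s) * (pq / s + p * u * q / s ^ 3)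
      + (1 + y ^ 2 * (p / s) ^ 2) * (qq / s + q * u * q / s ^ 3) = 0 := by
  rw [← hsu] at h
  field_simp
  linear_combination s ^ 2 * h

section

variable (a : ℝ) {x y : ℝ}

theorem hasDerivAt_fst_mul_div_sq_add_sq (hy : 0 < y) :
    HasDerivAt (fun t => a * y / (t ^ 2 + y ^ 2)) (-2 * a * x * y / (x ^ 2 + y ^ 2) ^ 2) x := by
  have hr : x ^ 2 + y ^ 2 ≠ 0 := by positivity
  have := (hasDerivAt_const x (a * y)).div ((hasDerivAt_pow 2 x).add_const (y ^ 2)) hr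
  refine this.congr_deriv ?_
  field_simp
  push_cast
  ring

theorem hasDerivAt_snd_mul_div_sq_add_sq (hy : 0 < y) :
    HasDerivAt (fun t => a * t / (x ^ 2 + t ^ 2))
      (a * (x ^ 2 - y ^ 2) / (x ^ 2 + y ^ 2) ^ 2) y := by
  have hr : x ^ 2 + y ^ 2 ≠ 0 := by positivity
  have := ((hasDerivAt_id y).const_mul a).div ((hasDerivAt_pow 2 y).const_add (x ^ 2)) hr
  refine this.congr_deriv ?_
  simp only [id]
  field_simp
  push_cast
  ring

theorem hasDerivAt_fst_fst_mul_div_sq_add_sq (hy : 0 < y) :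
    HasDerivAt (fun t => -2 * a * t * y / (t ^ 2 + y ^ 2) ^ 2)
      (2 * a * y * (3 * x ^ 2 - y ^ 2) / (x ^ 2 + y ^ 2) ^ 3) x := by
  have hr : x ^ 2 + y ^ 2 ≠ 0 := by positivity
  have := (((hasDerivAt_id x).const_mul (-2 * a)).mul_const y).div
    (((hasDerivAt_pow 2 x).add_const (y ^ 2)).pow 2) (pow_ne_zero 2 hr)
  refine this.congr_deriv ?_
  simp only [id, Pi.pow_apply]
  field_simp
  push_cast
  ring

theorem hasDerivAt_snd_fst_mul_div_sq_add_sq (hy : 0 < y) :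
    HasDerivAt (fun t => -2 * a * x * t / (x ^ 2 + t ^ 2) ^ 2)
      (-2 * a * x * (x ^ 2 - 3 * y ^ 2) / (x ^ 2 + y ^ 2) ^ 3) y := by
  have hr : x ^ 2 + y ^ 2 ≠ 0 := by positivity
  have := ((hasDerivAt_id y).const_mul (-2 * a * x)).div
    (((hasDerivAt_pow 2 y).const_add (x ^ 2)).pow 2) (pow_ne_zero 2 hr)
  refine this.congr_deriv ?_
  simp only [id, Pi.pow_apply]
  field_simp
  push_cast
  ring

theorem hasDerivAt_snd_snd_mul_div_sq_add_sq (hy : 0 < y) :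
    HasDerivAt (fun t => a * (x ^ 2 - t ^ 2) / (x ^ 2 + t ^ 2) ^ 2)
      (-(2 * a * y * (3 * x ^ 2 - y ^ 2)) / (x ^ 2 + y ^ 2) ^ 3) y := by
  have hr : x ^ 2 + y ^ 2 ≠ 0 := by positivity
  have := (((hasDerivAt_pow 2 y).const_sub (x ^ 2)).const_mul a).div
    (((hasDerivAt_pow 2 y).const_add (x ^ 2)).pow 2) (pow_ne_zero 2 hr)
  refine this.congr_deriv ?_
  simp only [Pi.pow_apply]
  field_simp
  push_cast
  ring

end

/-- `f(x,y) = arcsin(a y/(x² + y²)) + b` solves the minimal surface equation in `ℍ² × ℝ`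
at every point of the upper half-plane where `|a y/(x² + y²)| < 1`. -/
theorem arcsin_graph_is_minimal (a b : ℝ) :
    ∀ x y : ℝ, 0 < y → |a * y / (x ^ 2 + y ^ 2)| < 1 →
      MinimalEq (fun x y => Real.arcsin (a * y / (x ^ 2 + y ^ 2)) + b) x y := by
  intro x y hy h
  set f : ℝ → ℝ → ℝ := fun x y => Real.arcsin (a * y / (x ^ 2 + y ^ 2)) + b
  have hpx : ∀ x y : ℝ, 0 < y → |a * y / (x ^ 2 + y ^ 2)| < 1 → px f x y =
      -2 * a * x * y / (x ^ 2 + y ^ 2) ^ 2 / √(1 - (a * y / (x ^ 2 + y ^ 2)) ^ 2) :=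
    fun x y hy h => (hasDerivAt_arcsin_comp_add_const b
      (hasDerivAt_fst_mul_div_sq_add_sq a hy) h).deriv
  have hpy : ∀ x y : ℝ, 0 < y → |a * y / (x ^ 2 + y ^ 2)| < 1 → py f x y =
      a * (x ^ 2 - y ^ 2) / (x ^ 2 + y ^ 2) ^ 2 / √(1 - (a * y / (x ^ 2 + y ^ 2)) ^ 2) :=
    fun x y hy h => (hasDerivAt_arcsin_comp_add_const b
      (hasDerivAt_snd_mul_div_sq_add_sq a hy) h).deriv
  have hux := hasDerivAt_fst_mul_div_sq_add_sq a (x := x) hy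
  have huy := hasDerivAt_snd_mul_div_sq_add_sq a (x := x) hy
  have hnear_x : ∀ᶠ t in nhds x, |a * y / (t ^ 2 + y ^ 2)| < 1 :=
    hux.continuousAt.abs.eventually_lt_const h
  have hnear_y : ∀ᶠ t in nhds y, 0 < t ∧ |a * t / (x ^ 2 + t ^ 2)| < 1 :=
    (lt_mem_nhds hy).and (huy.continuousAt.abs.eventually_lt_const h)
  have hpxx := ((hasDerivAt_div_sqrt_one_sub_sq hux
    (hasDerivAt_fst_fst_mul_div_sq_add_sq a hy) h).congr_of_eventuallyEq
      (hnear_x.mono fun t ht => hpx t y hy ht)).deriv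
  have hpxy := ((hasDerivAt_div_sqrt_one_sub_sq huy
    (hasDerivAt_snd_fst_mul_div_sq_add_sq a hy) h).congr_of_eventuallyEq
      (hnear_y.mono fun t ht => hpx x t ht.1 ht.2)).deriv
  have hpyy := ((hasDerivAt_div_sqrt_one_sub_sq huy
    (hasDerivAt_snd_snd_mul_div_sq_add_sq a hy) h).congr_of_eventuallyEq
      (hnear_y.mono fun t ht => hpy x t ht.1 ht.2)).deriv
  have hpos : 0 < 1 - (a * y / (x ^ 2 + y ^ 2)) ^ 2 :=
    sub_pos.2 ((sq_lt_one_iff_abs_lt_one _).2 h)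
  have hr : x ^ 2 + y ^ 2 ≠ 0 := by positivity
  unfold MinimalEq minExpr
  rw [hpx x y hy h, hpy x y hy h, px, hpxx, py, hpxy, py, hpyy]
  refine minExpr_arcsin_comp_algebra (Real.sqrt_pos.2 hpos).ne' (Real.sq_sqrt hpos.le) ?_
  field_simp
  ring
end

section
/- Let h be a C² function on an open interval I ⊆ ℝ and define f(x,y) = h(y/(x² + y²)) on the open set of points (x,y) of the upper half-plane with y/(x² + y²) ∈ I. Then f satisfies the minimal surface equation in H²×ℝ on this set if and only if h''(z) − z·h'(z)³ = 0 for all z in the range of (x,y) ↦ y/(x² + y²) over this set. -/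
open Real MeasureTheory

theorem hasDerivAt_div_sq_add_sq_left {x y : ℝ} (hy : 0 < y) :
    HasDerivAt (fun t => y / (t ^ 2 + y ^ 2)) (-2 * x * y / (x ^ 2 + y ^ 2) ^ 2) x := by
  have hr : x ^ 2 + y ^ 2 ≠ 0 := by positivity
  refine ((hasDerivAt_const x y).fun_div
    (((hasDerivAt_id x).fun_pow 2).add_const (y ^ 2)) hr).congr_deriv ?_
  simp only [id]
  field_simp
  push_cast
  ring

theorem hasDerivAt_div_sq_add_sq_right {x y : ℝ} (hy : 0 < y) :
    HasDerivAt (fun t => t / (x ^ 2 + t ^ 2)) ((x ^ 2 - y ^ 2) / (x ^ 2 + y ^ 2) ^ 2) y := by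
  have hr : x ^ 2 + y ^ 2 ≠ 0 := by positivity
  refine ((hasDerivAt_id y).fun_div
    (((hasDerivAt_id y).fun_pow 2).const_add (x ^ 2)) hr).congr_deriv ?_
  simp only [id]
  field_simp
  push_cast
  ring

/-- On `y > 0`, the minimal surface operator applied to `h (y / (x² + y²))` is a positive
multiple of `h'' - z h'³` at `z = y / (x² + y²)`. -/
theorem minExpr_comp_div_sq_add_sq {I : Set ℝ} (hI : IsOpen I) {h : ℝ → ℝ}
    (hh : ContDiffOn ℝ 2 h I) {x y : ℝ} (hy : 0 < y) (hz : y / (x ^ 2 + y ^ 2) ∈ I) :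
    minExpr (fun x y => h (y / (x ^ 2 + y ^ 2))) x y =
      (deriv (deriv h) (y / (x ^ 2 + y ^ 2)) -
        y / (x ^ 2 + y ^ 2) * deriv h (y / (x ^ 2 + y ^ 2)) ^ 3) / (x ^ 2 + y ^ 2) ^ 2 := by
  have h1 {z : ℝ} (hz : z ∈ I) : HasDerivAt h (deriv h z) z :=
    ((hh.contDiffAt (hI.mem_nhds hz)).differentiableAt (by norm_num)).hasDerivAt
  have h2 {z : ℝ} (hz : z ∈ I) : HasDerivAt (deriv h) (deriv (deriv h) z) z := by
    have hd : ContDiffOn ℝ 1 (deriv h) I := hh.deriv_of_isOpen hI (by norm_num)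
    exact ((hd.contDiffAt (hI.mem_nhds hz)).differentiableAt (by norm_num)).hasDerivAt
  have hpx {a b : ℝ} (hb : 0 < b) (hab : b / (a ^ 2 + b ^ 2) ∈ I) :
      px (fun x y => h (y / (x ^ 2 + y ^ 2))) a b =
        deriv h (b / (a ^ 2 + b ^ 2)) * (-2 * a * b / (a ^ 2 + b ^ 2) ^ 2) :=
    ((h1 hab).comp a (hasDerivAt_div_sq_add_sq_left hb)).deriv
  have hpy {a b : ℝ} (hb : 0 < b) (hab : b / (a ^ 2 + b ^ 2) ∈ I) :
      py (fun x y => h (y / (x ^ 2 + y ^ 2))) a b =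
        deriv h (b / (a ^ 2 + b ^ 2)) * ((a ^ 2 - b ^ 2) / (a ^ 2 + b ^ 2) ^ 2) :=
    ((h1 hab).comp b (hasDerivAt_div_sq_add_sq_right hb)).deriv
  have hr : x ^ 2 + y ^ 2 ≠ 0 := by positivity
  have hr2 : (x ^ 2 + y ^ 2) ^ 2 ≠ 0 := by positivity
  have hzx := hasDerivAt_div_sq_add_sq_left (x := x) hy
  have hzy := hasDerivAt_div_sq_add_sq_right (x := x) hy
  have hevx : ∀ᶠ t in nhds x, y / (t ^ 2 + y ^ 2) ∈ I :=
    hzx.continuousAt.eventually (hI.mem_nhds hz)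
  have hevy : ∀ᶠ t in nhds y, 0 < t ∧ t / (x ^ 2 + t ^ 2) ∈ I :=
    (lt_mem_nhds hy).and (hzy.continuousAt.eventually (hI.mem_nhds hz))
  have hrx : HasDerivAt (fun t => (t ^ 2 + y ^ 2) ^ 2) (4 * x * (x ^ 2 + y ^ 2)) x :=
    ((((hasDerivAt_id x).fun_pow 2).add_const (y ^ 2)).fun_pow 2).congr_deriv
      (by simp only [id]; push_cast; ring)
  have hry : HasDerivAt (fun t => (x ^ 2 + t ^ 2) ^ 2) (4 * y * (x ^ 2 + y ^ 2)) y :=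
    ((((hasDerivAt_id y).fun_pow 2).const_add (x ^ 2)).fun_pow 2).congr_deriv
      (by simp only [id]; push_cast; ring)
  have hxx : px (px (fun x y => h (y / (x ^ 2 + y ^ 2)))) x y =
      deriv (deriv h) (y / (x ^ 2 + y ^ 2)) * (-2 * x * y / (x ^ 2 + y ^ 2) ^ 2) ^ 2 +
      deriv h (y / (x ^ 2 + y ^ 2)) *
        ((6 * x ^ 2 * y - 2 * y ^ 3) / (x ^ 2 + y ^ 2) ^ 3) := by
    have hnum : HasDerivAt (fun t => -2 * t * y) (-2 * y) x :=
      (((hasDerivAt_id x).const_mul (-2)).mul_const y).congr_deriv (by ring)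
    have key := ((h2 hz).comp x hzx).fun_mul (hnum.fun_div hrx hr2)
    refine ((key.congr_of_eventuallyEq (hevx.mono fun t ht => hpx hy ht)).deriv).trans ?_
    simp only [Function.comp_apply]
    field_simp
    ring
  have hxy : py (px (fun x y => h (y / (x ^ 2 + y ^ 2)))) x y =
      deriv (deriv h) (y / (x ^ 2 + y ^ 2)) * (-2 * x * y / (x ^ 2 + y ^ 2) ^ 2) *
        ((x ^ 2 - y ^ 2) / (x ^ 2 + y ^ 2) ^ 2) +
      deriv h (y / (x ^ 2 + y ^ 2)) *
        ((6 * x * y ^ 2 - 2 * x ^ 3) / (x ^ 2 + y ^ 2) ^ 3) := by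
    have hnum : HasDerivAt (fun t => -2 * x * t) (-2 * x) y :=
      ((hasDerivAt_id y).const_mul (-2 * x)).congr_deriv (by ring)
    have key := ((h2 hz).comp y hzy).fun_mul (hnum.fun_div hry hr2)
    refine ((key.congr_of_eventuallyEq (hevy.mono fun t ht => hpx ht.1 ht.2)).deriv).trans ?_
    simp only [Function.comp_apply]
    field_simp
    ring
  have hyy : py (py (fun x y => h (y / (x ^ 2 + y ^ 2)))) x y =
      deriv (deriv h) (y / (x ^ 2 + y ^ 2)) * ((x ^ 2 - y ^ 2) / (x ^ 2 + y ^ 2) ^ 2) ^ 2 +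
      deriv h (y / (x ^ 2 + y ^ 2)) *
        ((2 * y ^ 3 - 6 * x ^ 2 * y) / (x ^ 2 + y ^ 2) ^ 3) := by
    have hnum : HasDerivAt (fun t => x ^ 2 - t ^ 2) (-2 * y) y :=
      (((hasDerivAt_id y).fun_pow 2).const_sub (x ^ 2)).congr_deriv
        (by simp only [id]; push_cast; ring)
    have key := ((h2 hz).comp y hzy).fun_mul (hnum.fun_div hry hr2)
    refine ((key.congr_of_eventuallyEq (hevy.mono fun t ht => hpy ht.1 ht.2)).deriv).trans ?_
    simp only [Function.comp_apply]
    field_simp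
    ring
  rw [minExpr, hxx, hxy, hyy, hpx hy hz, hpy hy hz]
  generalize deriv (deriv h) (y / (x ^ 2 + y ^ 2)) = h''
  generalize deriv h (y / (x ^ 2 + y ^ 2)) = h'
  field_simp
  ring

/-- `f(x,y) = h(y/(x² + y²))` solves the minimal surface equation in `ℍ² × ℝ` on the set of
points of the upper half-plane where `y/(x² + y²) ∈ I` iff `h''(z) − z h'(z)³ = 0` for all
`z` in the range of `(x,y) ↦ y/(x² + y²)` over this set. -/
theorem minimal_graph_h_of_y_over_r2
    (I : Set ℝ) (hIo : IsOpen I) (hIc : I.OrdConnected)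
    (h : ℝ → ℝ) (hh : ContDiffOn ℝ 2 h I) :
    (∀ p : ℝ × ℝ, 0 < p.2 → p.2 / (p.1 ^ 2 + p.2 ^ 2) ∈ I →
        MinimalEq (fun x y => h (y / (x ^ 2 + y ^ 2))) p.1 p.2) ↔
      (∀ z : ℝ, (∃ p : ℝ × ℝ, 0 < p.2 ∧ p.2 / (p.1 ^ 2 + p.2 ^ 2) ∈ I ∧
            p.2 / (p.1 ^ 2 + p.2 ^ 2) = z) →
        deriv (deriv h) z - z * (deriv h z) ^ 3 = 0) := by
  have key (p : ℝ × ℝ) (hp : 0 < p.2) (hpI : p.2 / (p.1 ^ 2 + p.2 ^ 2) ∈ I) :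
      MinimalEq (fun x y => h (y / (x ^ 2 + y ^ 2))) p.1 p.2 ↔
        deriv (deriv h) (p.2 / (p.1 ^ 2 + p.2 ^ 2)) -
          p.2 / (p.1 ^ 2 + p.2 ^ 2) * deriv h (p.2 / (p.1 ^ 2 + p.2 ^ 2)) ^ 3 = 0 := by
    have hr : (p.1 ^ 2 + p.2 ^ 2) ^ 2 ≠ 0 := by positivity
    rw [MinimalEq, minExpr_comp_div_sq_add_sq hIo hh hp hpI, div_eq_zero_iff,
      or_iff_left hr]
  constructor
  · rintro H z ⟨p, hp, hpI, rfl⟩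
    exact (key p hp hpI).1 (H p hp hpI)
  · intro H p hp hpI
    exact (key p hp hpI).2 (H _ ⟨p, hp, hpI, rfl⟩)
end

section
/- Let Ω be a connected open subset of the upper half-plane {(x,y) ∈ ℝ² : y > 0} and let f : Ω → ℝ be C² satisfying the system f_xx = f_y/y, f_yy = −f_y/y, f_xy = −f_x/y on Ω. Then f is constant on Ω. (Equivalently: the only totally geodesic graphs z = f(x,y) in H²×ℝ are the horizontal planes z = c.) -/
open Real MeasureTheory

theorem hasDerivAt_px {f : ℝ → ℝ → ℝ} {p : ℝ × ℝ}
    (hf : DifferentiableAt ℝ (fun q : ℝ × ℝ => f q.1 q.2) p) :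
    HasDerivAt (fun t => f t p.2) (fderiv ℝ (fun q : ℝ × ℝ => f q.1 q.2) p (1, 0)) p.1 :=
  HasFDerivAt.comp_hasDerivAt (l := fun q : ℝ × ℝ => f q.1 q.2) p.1 hf.hasFDerivAt
    ((hasDerivAt_id p.1).prodMk (hasDerivAt_const p.1 p.2))

theorem hasDerivAt_py {f : ℝ → ℝ → ℝ} {p : ℝ × ℝ}
    (hf : DifferentiableAt ℝ (fun q : ℝ × ℝ => f q.1 q.2) p) :
    HasDerivAt (fun t => f p.1 t) (fderiv ℝ (fun q : ℝ × ℝ => f q.1 q.2) p (0, 1)) p.2 :=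
  HasFDerivAt.comp_hasDerivAt (l := fun q : ℝ × ℝ => f q.1 q.2) p.2 hf.hasFDerivAt
    ((hasDerivAt_const p.2 p.1).prodMk (hasDerivAt_id p.2))

theorem px_eq_fderiv {f : ℝ → ℝ → ℝ} {p : ℝ × ℝ}
    (hf : DifferentiableAt ℝ (fun q : ℝ × ℝ => f q.1 q.2) p) :
    px f p.1 p.2 = fderiv ℝ (fun q : ℝ × ℝ => f q.1 q.2) p (1, 0) :=
  (hasDerivAt_px hf).deriv

theorem py_eq_fderiv {f : ℝ → ℝ → ℝ} {p : ℝ × ℝ}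
    (hf : DifferentiableAt ℝ (fun q : ℝ × ℝ => f q.1 q.2) p) :
    py f p.1 p.2 = fderiv ℝ (fun q : ℝ × ℝ => f q.1 q.2) p (0, 1) :=
  (hasDerivAt_py hf).deriv

theorem fderiv_eq_px_py {f : ℝ → ℝ → ℝ} {p : ℝ × ℝ}
    (hf : DifferentiableAt ℝ (fun q : ℝ × ℝ => f q.1 q.2) p) :
    fderiv ℝ (fun q : ℝ × ℝ => f q.1 q.2) p =
      px f p.1 p.2 • ContinuousLinearMap.fst ℝ ℝ ℝ +
        py f p.1 p.2 • ContinuousLinearMap.snd ℝ ℝ ℝ := by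
  rw [px_eq_fderiv hf, py_eq_fderiv hf]
  ext <;> simp

section

variable {Ω : Set (ℝ × ℝ)} {f : ℝ → ℝ → ℝ}

theorem differentiableAt_of_contDiffOn_one (hΩ : IsOpen Ω)
    (hf : ContDiffOn ℝ 1 (fun p : ℝ × ℝ => f p.1 p.2) Ω) {p : ℝ × ℝ} (hp : p ∈ Ω) :
    DifferentiableAt ℝ (fun q : ℝ × ℝ => f q.1 q.2) p :=
  (hf.differentiableOn one_ne_zero).differentiableAt (hΩ.mem_nhds hp)

theorem contDiffOn_px (hΩ : IsOpen Ω)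
    (hf : ContDiffOn ℝ 2 (fun p : ℝ × ℝ => f p.1 p.2) Ω) :
    ContDiffOn ℝ 1 (fun p : ℝ × ℝ => px f p.1 p.2) Ω :=
  ((hf.fderiv_of_isOpen hΩ one_add_one_eq_two.le).clm_apply contDiffOn_const).congr fun _ hp =>
    px_eq_fderiv (differentiableAt_of_contDiffOn_one hΩ (hf.of_le one_le_two) hp)

theorem contDiffOn_py (hΩ : IsOpen Ω)
    (hf : ContDiffOn ℝ 2 (fun p : ℝ × ℝ => f p.1 p.2) Ω) :
    ContDiffOn ℝ 1 (fun p : ℝ × ℝ => py f p.1 p.2) Ω :=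
  ((hf.fderiv_of_isOpen hΩ one_add_one_eq_two.le).clm_apply contDiffOn_const).congr fun _ hp =>
    py_eq_fderiv (differentiableAt_of_contDiffOn_one hΩ (hf.of_le one_le_two) hp)

/-- Equality of mixed partial derivatives for `C²` functions. -/
theorem py_px_eq_px_py (hΩ : IsOpen Ω)
    (hf : ContDiffOn ℝ 2 (fun p : ℝ × ℝ => f p.1 p.2) Ω) {p : ℝ × ℝ} (hp : p ∈ Ω) :
    py (px f) p.1 p.2 = px (py f) p.1 p.2 := by
  set F : ℝ × ℝ → ℝ := fun q => f q.1 q.2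
  have hd : ∀ q ∈ Ω, DifferentiableAt ℝ F q := fun q hq =>
    differentiableAt_of_contDiffOn_one hΩ (hf.of_le one_le_two) hq
  have hD : DifferentiableAt ℝ (fderiv ℝ F) p :=
    ((hf.fderiv_of_isOpen hΩ one_add_one_eq_two.le).differentiableOn
      one_ne_zero).differentiableAt (hΩ.mem_nhds hp)
  have hx : (fun q : ℝ × ℝ => px f q.1 q.2) =ᶠ[nhds p] fun q => fderiv ℝ F q (1, 0) := by
    filter_upwards [hΩ.mem_nhds hp] with q hq using px_eq_fderiv (hd q hq)
  have hy : (fun q : ℝ × ℝ => py f q.1 q.2) =ᶠ[nhds p] fun q => fderiv ℝ F q (0, 1) := by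
    filter_upwards [hΩ.mem_nhds hp] with q hq using py_eq_fderiv (hd q hq)
  have happ : ∀ v w, fderiv ℝ (fun q => fderiv ℝ F q v) p w = fderiv ℝ (fderiv ℝ F) p w v := by
    intro v w
    rw [fderiv_clm_apply hD (differentiableAt_const v)]
    simp
  rw [py_eq_fderiv (differentiableAt_of_contDiffOn_one hΩ (contDiffOn_px hΩ hf) hp),
    px_eq_fderiv (differentiableAt_of_contDiffOn_one hΩ (contDiffOn_py hΩ hf) hp),
    hx.fderiv_eq, hy.fderiv_eq, happ, happ]
  exact ((hf.contDiffAt (hΩ.mem_nhds hp)).isSymmSndFDerivAt (by simp)) _ _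

theorem contDiffOn_two_of_px_py (hΩ : IsOpen Ω)
    (hf : ContDiffOn ℝ 1 (fun p : ℝ × ℝ => f p.1 p.2) Ω)
    (hx : ContDiffOn ℝ 1 (fun p : ℝ × ℝ => px f p.1 p.2) Ω)
    (hy : ContDiffOn ℝ 1 (fun p : ℝ × ℝ => py f p.1 p.2) Ω) :
    ContDiffOn ℝ 2 (fun p : ℝ × ℝ => f p.1 p.2) Ω := by
  rw [← one_add_one_eq_two, contDiffOn_succ_iff_fderiv_of_isOpen hΩ]
  refine ⟨hf.differentiableOn one_ne_zero, by simp, ?_⟩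
  exact ((hx.smul contDiffOn_const).add (hy.smul contDiffOn_const)).congr fun p hp =>
    fderiv_eq_px_py (differentiableAt_of_contDiffOn_one hΩ hf hp)

theorem px_congr (hΩ : IsOpen Ω) {g : ℝ → ℝ → ℝ} (h : ∀ p ∈ Ω, f p.1 p.2 = g p.1 p.2)
    {p : ℝ × ℝ} (hp : p ∈ Ω) : px f p.1 p.2 = px g p.1 p.2 := by
  refine Filter.EventuallyEq.deriv_eq ?_
  have hc : ContinuousAt (fun t : ℝ => (t, p.2)) p.1 := by fun_prop
  filter_upwards [hc.preimage_mem_nhds (hΩ.mem_nhds hp)] with t ht using h _ ht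

theorem py_congr (hΩ : IsOpen Ω) {g : ℝ → ℝ → ℝ} (h : ∀ p ∈ Ω, f p.1 p.2 = g p.1 p.2)
    {p : ℝ × ℝ} (hp : p ∈ Ω) : py f p.1 p.2 = py g p.1 p.2 := by
  refine Filter.EventuallyEq.deriv_eq ?_
  have hc : ContinuousAt (fun t : ℝ => (p.1, t)) p.2 := by fun_prop
  filter_upwards [hc.preimage_mem_nhds (hΩ.mem_nhds hp)] with t ht using h _ ht

end

/-- The only totally geodesic graphs in `ℍ² × ℝ` are horizontal planes: a `C²` solution of
`f_xx = f_y/y`, `f_yy = −f_y/y`, `f_xy = −f_x/y` on a connected open subset of the upper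
half-plane is constant. -/
theorem totally_geodesic_graphs_are_horizontal
    (Ω : Set (ℝ × ℝ)) (hΩo : IsOpen Ω) (hΩc : IsConnected Ω)
    (hΩsub : Ω ⊆ {p : ℝ × ℝ | 0 < p.2})
    (f : ℝ → ℝ → ℝ) (hf : ContDiffOn ℝ 2 (fun p : ℝ × ℝ => f p.1 p.2) Ω)
    (h1 : ∀ p ∈ Ω, px (px f) p.1 p.2 = py f p.1 p.2 / p.2)
    (h2 : ∀ p ∈ Ω, py (py f) p.1 p.2 = -(py f p.1 p.2) / p.2)
    (h3 : ∀ p ∈ Ω, py (px f) p.1 p.2 = -(px f p.1 p.2) / p.2) :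
    ∃ c : ℝ, ∀ p ∈ Ω, f p.1 p.2 = c := by
  have hy0 : ∀ p ∈ Ω, p.2 ≠ 0 := fun p hp => (hΩsub hp).ne'
  have hP := contDiffOn_px hΩo hf
  have hQ := contDiffOn_py hΩo hf
  have hPx : ContDiffOn ℝ 1 (fun p : ℝ × ℝ => px (px f) p.1 p.2) Ω :=
    (hQ.div contDiffOn_snd hy0).congr h1
  have hPy : ContDiffOn ℝ 1 (fun p : ℝ × ℝ => py (px f) p.1 p.2) Ω :=
    (hP.neg.div contDiffOn_snd hy0).congr h3
  have hP2 := contDiffOn_two_of_px_py hΩo hP hPx hPy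
  have hq : ∀ p ∈ Ω, py f p.1 p.2 = 0 := by
    intro p hp
    have hy := hy0 p hp
    have hQd := (hasDerivAt_py (differentiableAt_of_contDiffOn_one hΩo hQ hp))
    rw [← py_eq_fderiv (differentiableAt_of_contDiffOn_one hΩo hQ hp), h2 p hp] at hQd
    have hPd := (hasDerivAt_px (differentiableAt_of_contDiffOn_one hΩo hP hp))
    rw [← px_eq_fderiv (differentiableAt_of_contDiffOn_one hΩo hP hp), h1 p hp] at hPd
    have hmixed := py_px_eq_px_py hΩo hP2 hp
    have hl := py_congr hΩo (g := fun x y => py f x y / y) h1 hp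
    have hr := px_congr hΩo (g := fun x y => -(px f x y) / y) h3 hp
    have hl' := (hQd.fun_div (hasDerivAt_id' p.2) hy).deriv
    have hr' := (hPd.fun_neg.div_const p.2).deriv
    change py (fun x y => py f x y / y) p.1 p.2 = _ at hl'
    change px (fun x y => -(px f x y) / y) p.1 p.2 = _ at hr'
    rw [hl, hr, hl', hr'] at hmixed
    field_simp at hmixed
    linarith
  have hp0 : ∀ p ∈ Ω, px f p.1 p.2 = 0 := by
    intro p hp
    have hmixed := py_px_eq_px_py hΩo hf hp
    rw [h3 p hp, px_congr hΩo (g := fun _ _ => 0) hq hp] at hmixed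
    simpa [px, hy0 p hp] using hmixed
  refine hΩo.exists_is_const_of_fderiv_eq_zero hΩc.isPreconnected
    (hf.differentiableOn two_ne_zero) fun p hp => ?_
  rw [fderiv_eq_px_py (differentiableAt_of_contDiffOn_one hΩo (hf.of_le one_le_two) hp),
    hp0 p hp, hq p hp]
  simp
end

section
/- Let a be a C² function on an open interval I ⊆ ℝ with a(u) > 0 for all u ∈ I, satisfying the ODE a(u)·a''(u) + a'(u)² + 1 = 0 on I. Then there exist constants c₁, c₂ ∈ ℝ with c₁² + c₂ > 0 such that −u² + 2 c₁ u + c₂ > 0 and a(u) = √(−u² + 2 c₁ u + c₂) for all u ∈ I; that is, the curve (u, a(u)) lies on the upper semicircle with center (c₁, 0) and radius √(c₁² + c₂), a geodesic of the hyperbolic upper half-plane. -/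
open Real MeasureTheory

/-- A function with vanishing derivative on an open interval is constant there. -/
theorem exists_const_of_hasDerivAt_zero {I : Set ℝ} (hIo : IsOpen I) (hIc : I.OrdConnected)
    {f : ℝ → ℝ} (hf : ∀ u ∈ I, HasDerivAt f 0 u) : ∃ c, ∀ u ∈ I, f u = c :=
  hIo.exists_is_const_of_deriv_eq_zero hIc.isPreconnected
    (fun u hu => (hf u hu).differentiableAt.differentiableWithinAt) fun u hu => (hf u hu).deriv

/-- Positive solutions of `a a'' + (a')² + 1 = 0` on an open interval describe upper
semicircles centered on the `x`-axis (geodesics of the hyperbolic upper half-plane). -/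
theorem totally_geodesic_vertical_ode
    (I : Set ℝ) (hIo : IsOpen I) (hIc : I.OrdConnected)
    (a : ℝ → ℝ) (ha : ContDiffOn ℝ 2 a I) (hpos : ∀ u ∈ I, 0 < a u)
    (hode : ∀ u ∈ I, a u * deriv (deriv a) u + (deriv a u) ^ 2 + 1 = 0) :
    ∃ c₁ c₂ : ℝ, c₁ ^ 2 + c₂ > 0 ∧
      ∀ u ∈ I, -u ^ 2 + 2 * c₁ * u + c₂ > 0 ∧
        a u = Real.sqrt (-u ^ 2 + 2 * c₁ * u + c₂) := by
  rcases I.eq_empty_or_nonempty with rfl | ⟨u₀, hu₀⟩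
  · exact ⟨0, 1, by norm_num, by simp⟩
  have hda : ∀ u ∈ I, HasDerivAt a (deriv a u) u := fun u hu =>
    ((ha.differentiableOn (by norm_num)).differentiableAt (hIo.mem_nhds hu)).hasDerivAt
  have hda' : ∀ u ∈ I, HasDerivAt (deriv a) (deriv (deriv a) u) u := fun u hu =>
    (((ha.deriv_of_isOpen (m := 1) hIo (by norm_num)).differentiableOn
      (by norm_num)).differentiableAt (hIo.mem_nhds hu)).hasDerivAt
  obtain ⟨c₁, hc₁⟩ := exists_const_of_hasDerivAt_zero hIo hIc
    (f := fun u => a u * deriv a u + u) fun u hu => by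
      refine (((hda u hu).mul (hda' u hu)).add (hasDerivAt_id u)).congr_deriv ?_
      linear_combination hode u hu
  obtain ⟨c₂, hc₂⟩ := exists_const_of_hasDerivAt_zero hIo hIc
    (f := fun u => a u ^ 2 + u ^ 2 - 2 * c₁ * u) fun u hu => by
      refine ((((hda u hu).pow 2).add ((hasDerivAt_id u).pow 2)).sub
        ((hasDerivAt_id u).const_mul (2 * c₁))).congr_deriv ?_
      simp only [id, Nat.cast_ofNat]
      linear_combination 2 * hc₁ u hu
  have hsq : ∀ u ∈ I, -u ^ 2 + 2 * c₁ * u + c₂ = a u ^ 2 := fun u hu => by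
    linear_combination -hc₂ u hu
  refine ⟨c₁, c₂, ?_, fun u hu => ?_⟩
  · nlinarith [hsq u₀ hu₀, pow_pos (hpos u₀ hu₀) 2, sq_nonneg (u₀ - c₁)]
  · rw [hsq u hu]
    exact ⟨pow_pos (hpos u hu) 2, (Real.sqrt_sq (hpos u hu).le).symm⟩
end

section
/- Let c₁, c₂, c₃, c ∈ ℝ with j := 1 − c₂² − 2 c₁ c₃ > 0, set λ(x,y) = (1/y)·[(c₁/2)(x² + y²) + c₂ x − c₃], and define f(x,y) = arctan(λ(x,y)/√(j − λ(x,y)²)) + c on the open set U of points of the upper half-plane where j − λ(x,y)² > 0. Then f satisfies the umbilicity system on U: with w = √(y²(f_x² + f_y²) + 1)/y², one has ∂_y(f_x/(w y)) = 0, ∂_x(f_y/w) = −f_x/(w y), and ∂_x(f_x/w) = ∂_y(f_y/w). -/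
open Real MeasureTheory

/-- The function `w = √(y²(f_x² + f_y²) + 1)/y²` associated with a graph in `ℍ² × ℝ`. -/
noncomputable def wfun (f : ℝ → ℝ → ℝ) (x y : ℝ) : ℝ :=
  Real.sqrt (y ^ 2 * ((px f x y) ^ 2 + (py f x y) ^ 2) + 1) / y ^ 2

/-- The umbilicity system for the graph `z = f(x,y)` in `ℍ² × ℝ`:
`∂_y(f_x/(w y)) = 0`, `∂_x(f_y/w) = −f_x/(w y)`, `∂_x(f_x/w) = ∂_y(f_y/w)`. -/
def UmbilicSystem (f : ℝ → ℝ → ℝ) (x y : ℝ) : Prop :=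
  py (fun a b => px f a b / (wfun f a b * b)) x y = 0 ∧
  px (fun a b => py f a b / wfun f a b) x y = -px f x y / (wfun f x y * y) ∧
  px (fun a b => px f a b / wfun f a b) x y = py (fun a b => py f a b / wfun f a b) x y

/-- The chain rule for `arctan (u / √(j - u²))`, a primitive of `u' / √(j - u²)`. -/
lemma hasDerivAt_arctan_div_sqrt_sub_sq {u : ℝ → ℝ} {u' j c t : ℝ} (hu : HasDerivAt u u' t)
    (h : 0 < j - u t ^ 2) :
    HasDerivAt (fun s => Real.arctan (u s / Real.sqrt (j - u s ^ 2)) + c)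
      (u' / Real.sqrt (j - u t ^ 2)) t := by
  have hs : 0 < Real.sqrt (j - u t ^ 2) := Real.sqrt_pos.mpr h
  have hsq : Real.sqrt (j - u t ^ 2) ^ 2 = j - u t ^ 2 := Real.sq_sqrt h.le
  have hroot := ((hu.pow 2).const_sub j).sqrt h.ne'
  refine ((hu.div hroot hs.ne').arctan.add_const c).congr_deriv ?_
  simp only [Pi.div_apply, Pi.pow_apply]
  set r := Real.sqrt (j - u t ^ 2)
  have hj : j = r ^ 2 + u t ^ 2 := by linarith
  have hpos : 0 < r ^ 2 + u t ^ 2 := by positivity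
  field_simp
  ring

/-- The affine function `λ` on the hyperbolic plane whose arcsine gives the umbilic graph. -/
noncomputable def graphLambda (c₁ c₂ c₃ x y : ℝ) : ℝ :=
  (1 / y) * (c₁ / 2 * (x ^ 2 + y ^ 2) + c₂ * x - c₃)

/-- The function `arctan (λ / √(j - λ²)) + c` defining the umbilic graph. -/
noncomputable def umbilicGraph (c₁ c₂ c₃ c x y : ℝ) : ℝ :=
  Real.arctan (graphLambda c₁ c₂ c₃ x y
    / Real.sqrt ((1 - c₂ ^ 2 - 2 * c₁ * c₃) - graphLambda c₁ c₂ c₃ x y ^ 2)) + c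

section

variable {c₁ c₂ c₃ c x y : ℝ}

lemma hasDerivAt_graphLambda_fst :
    HasDerivAt (fun t => graphLambda c₁ c₂ c₃ t y) ((c₁ * x + c₂) / y) x := by
  have h := ((((((hasDerivAt_id x).pow 2).add_const (y ^ 2)).const_mul (c₁ / 2)).add
    ((hasDerivAt_id x).const_mul c₂)).sub_const c₃).const_mul (1 / y)
  refine h.congr_deriv ?_
  simp only [id]
  ring

lemma hasDerivAt_graphLambda_snd (hy : 0 < y) :
    HasDerivAt (fun t => graphLambda c₁ c₂ c₃ x t)
      ((c₁ / 2 * (y ^ 2 - x ^ 2) - c₂ * x + c₃) / y ^ 2) y := by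
  have h := ((hasDerivAt_id y).fun_inv hy.ne').mul
    (((((hasDerivAt_id y).pow 2).const_add (x ^ 2)).const_mul (c₁ / 2)).add_const
      (c₂ * x - c₃))
  refine (h.congr_of_eventuallyEq (.of_forall fun t => ?_)).congr_deriv ?_
  · simp only [graphLambda, Pi.mul_apply, Pi.pow_apply, id]
    ring
  · simp only [Pi.pow_apply, id]
    field_simp
    ring

lemma px_umbilicGraph
    (h : 0 < (1 - c₂ ^ 2 - 2 * c₁ * c₃) - graphLambda c₁ c₂ c₃ x y ^ 2) :
    px (umbilicGraph c₁ c₂ c₃ c) x y = (c₁ * x + c₂) / y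
      / Real.sqrt ((1 - c₂ ^ 2 - 2 * c₁ * c₃) - graphLambda c₁ c₂ c₃ x y ^ 2) :=
  (hasDerivAt_arctan_div_sqrt_sub_sq hasDerivAt_graphLambda_fst h).deriv

lemma py_umbilicGraph (hy : 0 < y)
    (h : 0 < (1 - c₂ ^ 2 - 2 * c₁ * c₃) - graphLambda c₁ c₂ c₃ x y ^ 2) :
    py (umbilicGraph c₁ c₂ c₃ c) x y = (c₁ / 2 * (y ^ 2 - x ^ 2) - c₂ * x + c₃) / y ^ 2
      / Real.sqrt ((1 - c₂ ^ 2 - 2 * c₁ * c₃) - graphLambda c₁ c₂ c₃ x y ^ 2) :=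
  (hasDerivAt_arctan_div_sqrt_sub_sq (hasDerivAt_graphLambda_snd hy) h).deriv

lemma wfun_umbilicGraph (hy : 0 < y)
    (h : 0 < (1 - c₂ ^ 2 - 2 * c₁ * c₃) - graphLambda c₁ c₂ c₃ x y ^ 2) :
    wfun (umbilicGraph c₁ c₂ c₃ c) x y =
      1 / (y ^ 2 *
        Real.sqrt ((1 - c₂ ^ 2 - 2 * c₁ * c₃) - graphLambda c₁ c₂ c₃ x y ^ 2)) := by
  have hs := Real.sqrt_pos.mpr h
  have hsq := Real.sq_sqrt h.le
  rw [wfun, px_umbilicGraph h, py_umbilicGraph hy h]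
  set r := Real.sqrt ((1 - c₂ ^ 2 - 2 * c₁ * c₃) - graphLambda c₁ c₂ c₃ x y ^ 2)
  have key : y ^ 2 * (((c₁ * x + c₂) / y / r) ^ 2
      + ((c₁ / 2 * (y ^ 2 - x ^ 2) - c₂ * x + c₃) / y ^ 2 / r) ^ 2) + 1 = (1 / r) ^ 2 := by
    rw [graphLambda] at hsq
    have hr : y ^ 2 * r ^ 2 = y ^ 2 * (1 - c₂ ^ 2 - 2 * c₁ * c₃)
        - (c₁ / 2 * (x ^ 2 + y ^ 2) + c₂ * x - c₃) ^ 2 := by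
      rw [hsq]
      field_simp
    field_simp
    linear_combination 4 * hr
  rw [key, Real.sqrt_sq (by positivity)]
  field_simp

lemma px_div_wfun_umbilicGraph (hy : 0 < y)
    (h : 0 < (1 - c₂ ^ 2 - 2 * c₁ * c₃) - graphLambda c₁ c₂ c₃ x y ^ 2) :
    px (umbilicGraph c₁ c₂ c₃ c) x y / wfun (umbilicGraph c₁ c₂ c₃ c) x y
      = (c₁ * x + c₂) * y := by
  have hs := Real.sqrt_pos.mpr h
  rw [px_umbilicGraph h, wfun_umbilicGraph hy h]
  set r := Real.sqrt ((1 - c₂ ^ 2 - 2 * c₁ * c₃) - graphLambda c₁ c₂ c₃ x y ^ 2)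
  field_simp

lemma py_div_wfun_umbilicGraph (hy : 0 < y)
    (h : 0 < (1 - c₂ ^ 2 - 2 * c₁ * c₃) - graphLambda c₁ c₂ c₃ x y ^ 2) :
    py (umbilicGraph c₁ c₂ c₃ c) x y / wfun (umbilicGraph c₁ c₂ c₃ c) x y
      = c₁ / 2 * (y ^ 2 - x ^ 2) - c₂ * x + c₃ := by
  have hs := Real.sqrt_pos.mpr h
  rw [py_umbilicGraph hy h, wfun_umbilicGraph hy h]
  set r := Real.sqrt ((1 - c₂ ^ 2 - 2 * c₁ * c₃) - graphLambda c₁ c₂ c₃ x y ^ 2)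
  field_simp

lemma umbilicSystem_umbilicGraph (hy : 0 < y)
    (h : 0 < (1 - c₂ ^ 2 - 2 * c₁ * c₃) - graphLambda c₁ c₂ c₃ x y ^ 2) :
    UmbilicSystem (umbilicGraph c₁ c₂ c₃ c) x y := by
  have hx_near : ∀ᶠ t in nhds x,
      0 < (1 - c₂ ^ 2 - 2 * c₁ * c₃) - graphLambda c₁ c₂ c₃ t y ^ 2 :=
    (continuousAt_const.sub (hasDerivAt_graphLambda_fst.continuousAt.pow 2)).eventually_const_lt h
  have hy_near : ∀ᶠ t in nhds y,
      0 < t ∧ 0 < (1 - c₂ ^ 2 - 2 * c₁ * c₃) - graphLambda c₁ c₂ c₃ x t ^ 2 :=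
    (eventually_gt_nhds hy).and
      ((continuousAt_const.sub
        ((hasDerivAt_graphLambda_snd hy).continuousAt.pow 2)).eventually_const_lt h)
  have hpoly_x : HasDerivAt (fun t => c₁ / 2 * (y ^ 2 - t ^ 2) - c₂ * t + c₃)
      (-(c₁ * x + c₂)) x := by
    refine ((((((hasDerivAt_id x).pow 2).const_sub (y ^ 2)).const_mul (c₁ / 2)).sub
      ((hasDerivAt_id x).const_mul c₂)).add_const c₃).congr_deriv ?_
    simp only [id]
    ring
  have hpoly_y : HasDerivAt (fun t => c₁ / 2 * (t ^ 2 - x ^ 2) - c₂ * x + c₃) (c₁ * y) y := by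
    refine ((((((hasDerivAt_id y).pow 2).sub_const (x ^ 2)).const_mul (c₁ / 2)).sub_const
      (c₂ * x)).add_const c₃).congr_deriv ?_
    simp only [id]
    ring
  have hlin : HasDerivAt (fun t => (c₁ * t + c₂) * y) (c₁ * y) x := by
    simpa using ((((hasDerivAt_id x).const_mul c₁).add_const c₂).mul_const y)
  refine ⟨?_, ?_, ?_⟩
  · refine ((hasDerivAt_const y (c₁ * x + c₂)).congr_of_eventuallyEq ?_).deriv
    filter_upwards [hy_near] with t ht
    rw [← div_div, px_div_wfun_umbilicGraph ht.1 ht.2, mul_div_cancel_right₀ _ ht.1.ne']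
  · rw [neg_div, ← div_div, px_div_wfun_umbilicGraph hy h, mul_div_cancel_right₀ _ hy.ne']
    refine (hpoly_x.congr_of_eventuallyEq ?_).deriv
    filter_upwards [hx_near] with t ht
    exact py_div_wfun_umbilicGraph hy ht
  · trans c₁ * y
    · refine (hlin.congr_of_eventuallyEq ?_).deriv
      filter_upwards [hx_near] with t ht
      exact px_div_wfun_umbilicGraph hy ht
    · refine (hpoly_y.congr_of_eventuallyEq ?_).deriv.symm
      filter_upwards [hy_near] with t ht
      exact py_div_wfun_umbilicGraph ht.1 ht.2

end

/-- The graph `f = arctan(λ/√(j − λ²)) + c`, with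
`λ(x,y) = (1/y)((c₁/2)(x² + y²) + c₂ x − c₃)` and `j = 1 − c₂² − 2 c₁ c₃ > 0`, satisfies the
umbilicity system on the open set of the upper half-plane where `j − λ² > 0`. -/
theorem umbilic_graph_satisfies_umbilicity_system
    (c₁ c₂ c₃ c : ℝ) (hj : 1 - c₂ ^ 2 - 2 * c₁ * c₃ > 0) :
    ∀ x y : ℝ, 0 < y →
      (1 - c₂ ^ 2 - 2 * c₁ * c₃)
          - ((1 / y) * (c₁ / 2 * (x ^ 2 + y ^ 2) + c₂ * x - c₃)) ^ 2 > 0 →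
      UmbilicSystem (fun x y =>
        Real.arctan (((1 / y) * (c₁ / 2 * (x ^ 2 + y ^ 2) + c₂ * x - c₃))
          / Real.sqrt ((1 - c₂ ^ 2 - 2 * c₁ * c₃)
              - ((1 / y) * (c₁ / 2 * (x ^ 2 + y ^ 2) + c₂ * x - c₃)) ^ 2)) + c) x y := by
  exact fun _ _ hy h => umbilicSystem_umbilicGraph hy h
end

section
/- Let Ω be a connected open subset of the upper half-plane {(x,y) ∈ ℝ² : y > 0} and let f : Ω → ℝ be a nonconstant C² solution of the umbilicity system on Ω: with w = √(y²(f_x² + f_y²) + 1)/y², ∂_y(f_x/(w y)) = 0, ∂_x(f_y/w) = −f_x/(w y), and ∂_x(f_x/w) = ∂_y(f_y/w). Then there exist constants c₁, c₂, c₃, c ∈ ℝ with j := 1 − c₂² − 2 c₁ c₃ > 0 such that, setting λ(x,y) = (1/y)·[(c₁/2)(x² + y²) + c₂ x − c₃], one has j − λ(x,y)² > 0 and f(x,y) = arctan(λ(x,y)/√(j − λ(x,y)²)) + c for all (x,y) ∈ Ω. -/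
open Real MeasureTheory

theorem differentiableAt_fun_div {E : Type*} [NormedAddCommGroup E] [NormedSpace ℝ E]
    {u v : E → ℝ} {p : E} (hu : DifferentiableAt ℝ u p) (hv : DifferentiableAt ℝ v p)
    (h : v p ≠ 0) : DifferentiableAt ℝ (fun p => u p / v p) p := by
  simpa only [div_eq_mul_inv] using hu.fun_mul (hv.fun_inv h)

theorem hasDerivAt_fst_section {F : ℝ × ℝ → ℝ} {x y : ℝ} (h : DifferentiableAt ℝ F (x, y)) :
    HasDerivAt (fun t => F (t, y)) (fderiv ℝ F (x, y) (1, 0)) x :=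
  h.hasFDerivAt.comp_hasDerivAt x ((hasDerivAt_id x).prodMk (hasDerivAt_const x y))

theorem hasDerivAt_snd_section {F : ℝ × ℝ → ℝ} {x y : ℝ} (h : DifferentiableAt ℝ F (x, y)) :
    HasDerivAt (fun t => F (x, t)) (fderiv ℝ F (x, y) (0, 1)) y :=
  h.hasFDerivAt.comp_hasDerivAt y ((hasDerivAt_const y x).prodMk (hasDerivAt_id y))

theorem hasDerivAt_px_s19 {g : ℝ → ℝ → ℝ} {x y : ℝ}
    (h : DifferentiableAt ℝ (fun p : ℝ × ℝ => g p.1 p.2) (x, y)) :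
    HasDerivAt (fun t => g t y) (px g x y) x :=
  (hasDerivAt_fst_section h).differentiableAt.hasDerivAt

theorem hasDerivAt_py_s19 {g : ℝ → ℝ → ℝ} {x y : ℝ}
    (h : DifferentiableAt ℝ (fun p : ℝ × ℝ => g p.1 p.2) (x, y)) :
    HasDerivAt (fun t => g x t) (py g x y) y :=
  (hasDerivAt_snd_section h).differentiableAt.hasDerivAt

/-- A differentiable function on a connected open set whose partial derivatives vanish is
constant. -/
theorem exists_const_of_partials_eq_zero {Ω : Set (ℝ × ℝ)} (ho : IsOpen Ω)
    (hc : IsPreconnected Ω) {g : ℝ → ℝ → ℝ}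
    (hg : ∀ p ∈ Ω, DifferentiableAt ℝ (fun p : ℝ × ℝ => g p.1 p.2) p)
    (hx : ∀ p ∈ Ω, HasDerivAt (fun t => g t p.2) 0 p.1)
    (hy : ∀ p ∈ Ω, HasDerivAt (fun t => g p.1 t) 0 p.2) :
    ∃ k, ∀ p ∈ Ω, g p.1 p.2 = k := by
  refine ho.exists_is_const_of_fderiv_eq_zero (f := fun p : ℝ × ℝ => g p.1 p.2) hc
    (fun p hp => (hg p hp).differentiableWithinAt) fun p hp => ?_
  have h1 := (hasDerivAt_fst_section (hg p hp)).unique (hx p hp)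
  have h2 := (hasDerivAt_snd_section (hg p hp)).unique (hy p hp)
  ext
  · simpa using h1
  · simpa using h2

/-- If `∂_y a = 0`, `∂_x q = -a` and `∂_y q = y ∂_x a`, then `∂_x a` is locally constant. -/
theorem px_eventually_const {Ω : Set (ℝ × ℝ)} (ho : IsOpen Ω)
    (hpos : ∀ p ∈ Ω, 0 < p.2) {a q : ℝ → ℝ → ℝ}
    (hay : ∀ p ∈ Ω, HasDerivAt (fun t => a p.1 t) 0 p.2)
    (hqx : ∀ p ∈ Ω, HasDerivAt (fun t => q t p.2) (-a p.1 p.2) p.1)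
    (hqy : ∀ p ∈ Ω, HasDerivAt (fun t => q p.1 t) (p.2 * px a p.1 p.2) p.2)
    {p₀ : ℝ × ℝ} (hp₀ : p₀ ∈ Ω) :
    ∀ᶠ p in nhds p₀, px a p.1 p.2 = px a p₀.1 p₀.2 := by
  obtain ⟨x₀, y₀⟩ := p₀
  obtain ⟨r, hr, hball⟩ := Metric.isOpen_iff.1 ho _ hp₀
  rw [← ball_prod_same] at hball
  set I := Metric.ball x₀ r
  set J := Metric.ball y₀ r
  have hx₀ : x₀ ∈ I := Metric.mem_ball_self hr
  have hy₀ : y₀ ∈ J := Metric.mem_ball_self hr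
  have hIJ : ∀ x ∈ I, ∀ y ∈ J, (x, y) ∈ Ω := fun x hx y hy => hball ⟨hx, hy⟩
  have hIp : IsPreconnected I := (convex_ball x₀ r).isPreconnected
  have hJp : IsPreconnected J := (convex_ball y₀ r).isPreconnected
  have const_on : ∀ {K : Set ℝ} {u : ℝ → ℝ}, IsOpen K → IsPreconnected K →
      (∀ t ∈ K, HasDerivAt u 0 t) → ∀ s ∈ K, ∀ t ∈ K, u s = u t :=
    fun hK hKp hu s hs t ht => hK.is_const_of_deriv_eq_zero hKp
      (fun t ht => (hu t ht).differentiableAt.differentiableWithinAt)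
      (fun t ht => (hu t ht).deriv) hs ht
  have ha_eq : ∀ x ∈ I, ∀ y ∈ J, a x y = a x y₀ := fun x hx y hy =>
    const_on (u := fun t => a x t) Metric.isOpen_ball hJp
      (fun t ht => hay _ (hIJ x hx t ht)) y hy y₀ hy₀
  have hpx_eq : ∀ x ∈ I, ∀ y ∈ J, px a x y = px a x y₀ := fun x hx y hy => by
    refine Filter.EventuallyEq.deriv_eq ?_
    filter_upwards [Metric.isOpen_ball.mem_nhds hx] with t ht using ha_eq t ht y hy
  have hq : ∀ x ∈ I, ∀ y ∈ J, q x y - y ^ 2 / 2 * px a x y₀ = q x y₀ - y₀ ^ 2 / 2 * px a x y₀ :=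
    fun x hx y hy => by
      refine const_on (u := fun t => q x t - t ^ 2 / 2 * px a x y₀) Metric.isOpen_ball hJp
        (fun t ht => ?_) y hy y₀ hy₀
      have h1 := hqy _ (hIJ x hx t ht)
      simp only [hpx_eq x hx t ht] at h1
      have h2 := (((hasDerivAt_id t).pow 2).div_const 2).mul_const (px a x y₀)
      refine (h1.sub h2).congr_deriv ?_
      simp
  set y₁ := y₀ + r / 2 with hy₁def
  have hy₁ : y₁ ∈ J := by
    simp only [J, Metric.mem_ball, Real.dist_eq, hy₁def, add_sub_cancel_left]
    rw [abs_of_pos (by positivity)]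
    linarith
  have hy₀pos : 0 < y₀ := hpos _ hp₀
  have hne : y₁ ^ 2 / 2 - y₀ ^ 2 / 2 ≠ 0 := by
    rw [hy₁def]
    have : 0 < y₀ * r + r ^ 2 / 4 := by positivity
    nlinarith
  have hconst : ∀ x ∈ I, px a x y₀ = px a x₀ y₀ := fun x hx => by
    have h := const_on (u := fun t => q t y₁ - q t y₀) Metric.isOpen_ball hIp (fun t ht => by
      have h1 : HasDerivAt (fun t => q t y₁) (-a t y₁) t := hqx _ (hIJ t ht y₁ hy₁)
      have h0 : HasDerivAt (fun t => q t y₀) (-a t y₀) t := hqx _ (hIJ t ht y₀ hy₀)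
      exact (h1.sub h0).congr_deriv (by rw [ha_eq t ht y₁ hy₁, sub_self])) x hx x₀ hx₀
    refine mul_left_cancel₀ hne ?_
    linarith [hq x hx y₁ hy₁, hq x₀ hx₀ y₁ hy₁]
  have hnhds : I ×ˢ J ∈ nhds (x₀, y₀) :=
    prod_mem_nhds (Metric.ball_mem_nhds _ hr) (Metric.ball_mem_nhds _ hr)
  filter_upwards [hnhds] with p hp
  rw [hpx_eq _ hp.1 _ hp.2, hconst _ hp.1]

/-- Integration of the linear system `∂_y a = 0`, `∂_x q = -a`, `∂_y q = y ∂_x a`. -/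
theorem exists_linear_system_solution {Ω : Set (ℝ × ℝ)} (ho : IsOpen Ω)
    (hc : IsConnected Ω) (hpos : ∀ p ∈ Ω, 0 < p.2) {a q : ℝ → ℝ → ℝ}
    (ha : ∀ p ∈ Ω, DifferentiableAt ℝ (fun p : ℝ × ℝ => a p.1 p.2) p)
    (hq : ∀ p ∈ Ω, DifferentiableAt ℝ (fun p : ℝ × ℝ => q p.1 p.2) p)
    (hay : ∀ p ∈ Ω, HasDerivAt (fun t => a p.1 t) 0 p.2)
    (hqx : ∀ p ∈ Ω, HasDerivAt (fun t => q t p.2) (-a p.1 p.2) p.1)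
    (hqy : ∀ p ∈ Ω, HasDerivAt (fun t => q p.1 t) (p.2 * px a p.1 p.2) p.2) :
    ∃ c₁ c₂ c₃ : ℝ, ∀ p ∈ Ω, a p.1 p.2 = c₁ * p.1 + c₂ ∧
      q p.1 p.2 = c₁ / 2 * (p.2 ^ 2 - p.1 ^ 2) - c₂ * p.1 + c₃ := by
  obtain ⟨p₀, hp₀⟩ := hc.nonempty
  set c₁ := px a p₀.1 p₀.2
  have hc₁ : ∀ p ∈ Ω, px a p.1 p.2 = c₁ := by
    have hloc : ∀ p ∈ Ω, ∀ᶠ p' in nhdsWithin p Ω, px a p.1 p.2 = px a p'.1 p'.2 :=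
      fun p hp => ((px_eventually_const ho hpos hay hqx hqy hp).filter_mono
        nhdsWithin_le_nhds).mono fun _ h => h.symm
    exact fun p hp => (hc.isPreconnected.induction₂
      (fun p p' => px a p.1 p.2 = px a p'.1 p'.2) hloc
      (fun _ _ _ _ _ _ h h' => h.trans h') (fun _ _ _ _ h => h.symm) hp hp₀)
  obtain ⟨c₂, hc₂⟩ := exists_const_of_partials_eq_zero ho hc.isPreconnected
    (g := fun x y => a x y - c₁ * x)
    (fun p hp => (ha p hp).sub (by fun_prop))
    (fun p hp => by
      have h := (hasDerivAt_px_s19 (ha p hp)).sub ((hasDerivAt_id p.1).const_mul c₁)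
      exact h.congr_deriv (by rw [hc₁ p hp]; ring))
    (fun p hp => (hay p hp).sub_const _)
  have ha' : ∀ p ∈ Ω, a p.1 p.2 = c₁ * p.1 + c₂ := fun p hp => by linarith [hc₂ p hp]
  obtain ⟨c₃, hc₃⟩ := exists_const_of_partials_eq_zero ho hc.isPreconnected
    (g := fun x y => q x y - (c₁ / 2 * (y ^ 2 - x ^ 2) - c₂ * x))
    (fun p hp => (hq p hp).sub (by fun_prop))
    (fun p hp => by
      have h := (hqx p hp).sub (((((hasDerivAt_id p.1).pow 2).const_sub (p.2 ^ 2)).const_mul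
        (c₁ / 2)).sub ((hasDerivAt_id p.1).const_mul c₂))
      refine h.congr_deriv ?_
      rw [ha' p hp]
      simp
      ring)
    (fun p hp => by
      have h := (hqy p hp).sub (((((hasDerivAt_id p.2).pow 2).sub_const (p.1 ^ 2)).const_mul
        (c₁ / 2)).sub_const (c₂ * p.1))
      refine h.congr_deriv ?_
      rw [hc₁ p hp]
      simp
      ring)
  exact ⟨c₁, c₂, c₃, fun p hp => ⟨ha' p hp, by linarith [hc₃ p hp]⟩⟩

theorem hasDerivAt_arctan_div_sqrt {u : ℝ → ℝ} {u' j t : ℝ} (hu : HasDerivAt u u' t)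
    (h : 0 < j - u t ^ 2) :
    HasDerivAt (fun s => arctan (u s / √(j - u s ^ 2))) (u' / √(j - u t ^ 2)) t := by
  have hs : 0 < √(j - u t ^ 2) := sqrt_pos.2 h
  have hsq : √(j - u t ^ 2) ^ 2 = j - u t ^ 2 := sq_sqrt h.le
  have hj : 0 < j := by nlinarith [sq_nonneg (u t)]
  have h1 := (hu.div (((hu.pow 2).const_sub j).sqrt h.ne') hs.ne').arctan
  refine h1.congr_deriv ?_
  simp only [Pi.div_apply, Pi.pow_apply]
  set s := √(j - u t ^ 2)
  have hj' : j = s ^ 2 + u t ^ 2 := by linarith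
  have : s ^ 2 + u t ^ 2 ≠ 0 := hj' ▸ hj.ne'
  field_simp
  norm_num
  ring

theorem differentiableAt_px_py {Ω : Set (ℝ × ℝ)} (ho : IsOpen Ω) {f : ℝ → ℝ → ℝ}
    (hf : ContDiffOn ℝ 2 (fun p : ℝ × ℝ => f p.1 p.2) Ω) {p : ℝ × ℝ} (hp : p ∈ Ω) :
    DifferentiableAt ℝ (fun p : ℝ × ℝ => px f p.1 p.2) p ∧
      DifferentiableAt ℝ (fun p : ℝ × ℝ => py f p.1 p.2) p := by
  have hd : ∀ p ∈ Ω, DifferentiableAt ℝ (fun p : ℝ × ℝ => f p.1 p.2) p := fun p hp =>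
    (hf.contDiffAt (ho.mem_nhds hp)).differentiableAt (by norm_num)
  have hD : DifferentiableAt ℝ (fderiv ℝ (fun p : ℝ × ℝ => f p.1 p.2)) p :=
    ((hf.contDiffAt (ho.mem_nhds hp)).fderiv_right (m := 1) (by norm_num)).differentiableAt
      (by norm_num)
  constructor
  · refine (hD.clm_apply (differentiableAt_const ((1 : ℝ), (0 : ℝ)))).congr_of_eventuallyEq ?_
    filter_upwards [ho.mem_nhds hp] with p hp using (hasDerivAt_fst_section (hd p hp)).deriv
  · refine (hD.clm_apply (differentiableAt_const ((0 : ℝ), (1 : ℝ)))).congr_of_eventuallyEq ?_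
    filter_upwards [ho.mem_nhds hp] with p hp using (hasDerivAt_snd_section (hd p hp)).deriv

theorem wfun_pos (f : ℝ → ℝ → ℝ) (x : ℝ) {y : ℝ} (hy : 0 < y) : 0 < wfun f x y := by
  unfold wfun
  positivity

theorem differentiableAt_wfun {f : ℝ → ℝ → ℝ} {p : ℝ × ℝ} (hy : 0 < p.2)
    (hx' : DifferentiableAt ℝ (fun p : ℝ × ℝ => px f p.1 p.2) p)
    (hy' : DifferentiableAt ℝ (fun p : ℝ × ℝ => py f p.1 p.2) p) :
    DifferentiableAt ℝ (fun p : ℝ × ℝ => wfun f p.1 p.2) p := by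
  unfold wfun
  have hne : p.2 ^ 2 * (px f p.1 p.2 ^ 2 + py f p.1 p.2 ^ 2) + 1 ≠ 0 := by positivity
  have hne' : p.2 ^ 2 ≠ 0 := by positivity
  have hnum : DifferentiableAt ℝ
      (fun p : ℝ × ℝ => p.2 ^ 2 * (px f p.1 p.2 ^ 2 + py f p.1 p.2 ^ 2) + 1) p := by
    fun_prop
  have hden : DifferentiableAt ℝ (fun p : ℝ × ℝ => p.2 ^ 2) p := by fun_prop
  exact differentiableAt_fun_div (hnum.sqrt hne) hden hne'

/-- Classification of umbilical graphs in `ℍ² × ℝ`: a nonconstant `C²` solution of the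
umbilicity system on a connected open subset of the upper half-plane is of the form
`f = arctan(λ/√(j − λ²)) + c` with `λ(x,y) = (1/y)((c₁/2)(x² + y²) + c₂ x − c₃)` and
`j = 1 − c₂² − 2 c₁ c₃ > 0`. -/
theorem umbilical_graphs_classification
    (Ω : Set (ℝ × ℝ)) (hΩo : IsOpen Ω) (hΩc : IsConnected Ω)
    (hΩsub : Ω ⊆ {p : ℝ × ℝ | 0 < p.2})
    (f : ℝ → ℝ → ℝ) (hf : ContDiffOn ℝ 2 (fun p : ℝ × ℝ => f p.1 p.2) Ω)
    (hnc : ¬∃ c : ℝ, ∀ p ∈ Ω, f p.1 p.2 = c)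
    (humb : ∀ p ∈ Ω, UmbilicSystem f p.1 p.2) :
    ∃ c₁ c₂ c₃ c : ℝ, 1 - c₂ ^ 2 - 2 * c₁ * c₃ > 0 ∧
      ∀ p ∈ Ω,
        (1 - c₂ ^ 2 - 2 * c₁ * c₃)
            - ((1 / p.2) * (c₁ / 2 * (p.1 ^ 2 + p.2 ^ 2) + c₂ * p.1 - c₃)) ^ 2 > 0 ∧
        f p.1 p.2 = Real.arctan
            (((1 / p.2) * (c₁ / 2 * (p.1 ^ 2 + p.2 ^ 2) + c₂ * p.1 - c₃))
              / Real.sqrt ((1 - c₂ ^ 2 - 2 * c₁ * c₃)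
                - ((1 / p.2) * (c₁ / 2 * (p.1 ^ 2 + p.2 ^ 2) + c₂ * p.1 - c₃)) ^ 2)) + c := by
  have hpos : ∀ p ∈ Ω, 0 < p.2 := fun p hp => hΩsub hp
  have hd : ∀ p ∈ Ω, DifferentiableAt ℝ (fun p : ℝ × ℝ => f p.1 p.2) p := fun p hp =>
    (hf.contDiffAt (hΩo.mem_nhds hp)).differentiableAt (by norm_num)
  have hdw : ∀ p ∈ Ω, DifferentiableAt ℝ (fun p : ℝ × ℝ => wfun f p.1 p.2) p := fun p hp =>
    differentiableAt_wfun (hpos p hp) (differentiableAt_px_py hΩo hf hp).1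
      (differentiableAt_px_py hΩo hf hp).2
  have hda : ∀ p ∈ Ω, DifferentiableAt ℝ
      (fun p : ℝ × ℝ => px f p.1 p.2 / (wfun f p.1 p.2 * p.2)) p := fun p hp => by
    have hden := (hdw p hp).fun_mul differentiableAt_snd
    exact differentiableAt_fun_div (differentiableAt_px_py hΩo hf hp).1 hden
      (mul_pos (wfun_pos f _ (hpos p hp)) (hpos p hp)).ne'
  have hdq : ∀ p ∈ Ω, DifferentiableAt ℝ
      (fun p : ℝ × ℝ => py f p.1 p.2 / wfun f p.1 p.2) p := fun p hp =>
    differentiableAt_fun_div (differentiableAt_px_py hΩo hf hp).2 (hdw p hp)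
      (wfun_pos f _ (hpos p hp)).ne'
  obtain ⟨c₁, c₂, c₃, hsol⟩ := exists_linear_system_solution hΩo hΩc hpos
    (a := fun x y => px f x y / (wfun f x y * y)) (q := fun x y => py f x y / wfun f x y)
    hda hdq
    (fun p hp => (hasDerivAt_py_s19 (hda p hp)).congr_deriv (humb p hp).1)
    (fun p hp => (hasDerivAt_px_s19 (hdq p hp)).congr_deriv
      ((humb p hp).2.1.trans (neg_div _ _)))
    (fun p hp => by
      have hqy := hasDerivAt_py_s19 (g := fun x y => py f x y / wfun f x y) (hdq p hp)
      refine hqy.congr_deriv ?_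
      refine (humb p hp).2.2.symm.trans ?_
      have h := (hasDerivAt_px_s19 (g := fun x y => px f x y / (wfun f x y * y))
        (hda p hp)).const_mul p.2
      rw [← h.deriv]
      unfold px
      congr 1
      funext t
      have := (hpos p hp).ne'
      have := (wfun_pos f t (hpos p hp)).ne'
      field_simp)
  set L : ℝ → ℝ → ℝ := fun x y => (1 / y) * (c₁ / 2 * (x ^ 2 + y ^ 2) + c₂ * x - c₃) with hL
  set j := 1 - c₂ ^ 2 - 2 * c₁ * c₃ with hj
  have hLx : ∀ p ∈ Ω, HasDerivAt (fun t => L t p.2)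
      (px f p.1 p.2 / (wfun f p.1 p.2 * p.2 ^ 2)) p.1 := fun p hp => by
    have hy := (hpos p hp).ne'
    have hw := (wfun_pos f p.1 (hpos p hp)).ne'
    have h := ((((((hasDerivAt_id p.1).pow 2).add_const (p.2 ^ 2)).const_mul (c₁ / 2)).add
      ((hasDerivAt_id p.1).const_mul c₂)).sub_const c₃).const_mul (1 / p.2)
    refine h.congr_deriv ?_
    have h1 := (hsol p hp).1
    have h2 : px f p.1 p.2 / (wfun f p.1 p.2 * p.2 ^ 2)
        = 1 / p.2 * (px f p.1 p.2 / (wfun f p.1 p.2 * p.2)) := by field_simp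
    rw [h2, h1]
    push_cast [id]
    ring
  have hLy : ∀ p ∈ Ω, HasDerivAt (fun t => L p.1 t)
      (py f p.1 p.2 / (wfun f p.1 p.2 * p.2 ^ 2)) p.2 := fun p hp => by
    have hy := (hpos p hp).ne'
    have hw := (wfun_pos f p.1 (hpos p hp)).ne'
    have h := (((hasDerivAt_const p.2 (1 : ℝ)).div (hasDerivAt_id p.2) hy)).mul
      ((((((hasDerivAt_id p.2).pow 2).const_add (p.1 ^ 2)).const_mul (c₁ / 2)).add_const
      (c₂ * p.1)).sub_const c₃)
    refine h.congr_deriv ?_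
    have h1 := (hsol p hp).2
    have h2 : py f p.1 p.2 / (wfun f p.1 p.2 * p.2 ^ 2)
        = 1 / p.2 ^ 2 * (py f p.1 p.2 / wfun f p.1 p.2) := by field_simp
    rw [h2, h1]
    simp
    field_simp
    ring
  have hjL : ∀ p ∈ Ω, j - L p.1 p.2 ^ 2 = (1 / (wfun f p.1 p.2 * p.2 ^ 2)) ^ 2 := fun p hp => by
    have hy := (hpos p hp).ne'
    have hw := (wfun_pos f p.1 (hpos p hp)).ne'
    have hw2 : (wfun f p.1 p.2 * p.2 ^ 2) ^ 2
        = p.2 ^ 2 * (px f p.1 p.2 ^ 2 + py f p.1 p.2 ^ 2) + 1 := by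
      rw [wfun, div_mul_cancel₀ _ (pow_ne_zero 2 hy), sq_sqrt (by positivity)]
    obtain ⟨h1, h2⟩ := hsol p hp
    have h3 : j - L p.1 p.2 ^ 2 = 1 - (c₁ * p.1 + c₂) ^ 2
        - ((c₁ / 2 * (p.2 ^ 2 - p.1 ^ 2) - c₂ * p.1 + c₃) / p.2) ^ 2 := by
      simp only [hL, hj]
      field_simp
      ring
    rw [h3, ← h1, ← h2]
    field_simp
    linarith
  have hjLpos : ∀ p ∈ Ω, 0 < j - L p.1 p.2 ^ 2 := fun p hp => by
    rw [hjL p hp]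
    have := hpos p hp
    have := wfun_pos f p.1 this
    positivity
  have hsqrt : ∀ p ∈ Ω, √(j - L p.1 p.2 ^ 2) = 1 / (wfun f p.1 p.2 * p.2 ^ 2) := fun p hp => by
    have := hpos p hp
    have := wfun_pos f p.1 this
    rw [hjL p hp, sqrt_sq (by positivity)]
  obtain ⟨c, hc⟩ := exists_const_of_partials_eq_zero hΩo hΩc.isPreconnected
    (g := fun x y => f x y - arctan (L x y / √(j - L x y ^ 2)))
    (fun p hp => by
      have hy := (hpos p hp).ne'
      have hdL : DifferentiableAt ℝ (fun p : ℝ × ℝ => L p.1 p.2) p := by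
        have h1 : DifferentiableAt ℝ (fun p : ℝ × ℝ => 1 / p.2) p :=
          differentiableAt_fun_div (differentiableAt_const 1) differentiableAt_snd hy
        exact h1.fun_mul (by fun_prop)
      exact (hd p hp).sub (differentiableAt_fun_div hdL (((hdL.fun_pow 2).const_sub j).sqrt (hjLpos p hp).ne')
        (sqrt_pos.2 (hjLpos p hp)).ne').arctan)
    (fun p hp => by
      have hy := (hpos p hp).ne'
      have hw := (wfun_pos f p.1 (hpos p hp)).ne'
      refine ((hasDerivAt_px_s19 (hd p hp)).sub
        (hasDerivAt_arctan_div_sqrt (hLx p hp) (hjLpos p hp))).congr_deriv ?_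
      rw [hsqrt p hp]
      field_simp
      ring)
    (fun p hp => by
      have hy := (hpos p hp).ne'
      have hw := (wfun_pos f p.1 (hpos p hp)).ne'
      refine ((hasDerivAt_py_s19 (hd p hp)).sub
        (hasDerivAt_arctan_div_sqrt (hLy p hp) (hjLpos p hp))).congr_deriv ?_
      rw [hsqrt p hp]
      field_simp
      ring)
  refine ⟨c₁, c₂, c₃, c, ?_, fun p hp => ⟨hjLpos p hp, by linarith [hc p hp]⟩⟩
  obtain ⟨p, hp⟩ := hΩc.nonempty
  exact lt_of_lt_of_le (hjLpos p hp) (sub_le_self _ (sq_nonneg _))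
end
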